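/- arXiv:2110.09555 — 2 statements merged into one kernel-verified Lean document; each statement's English description precedes it below -/
import Mathlib

section
/- Let d ≥ 1, q ∈ (1, ∞), α ∈ (0, (d+2)/q), and let r be defined by (d+2)/q − α = (d+2)/r. Then there exists a constant N = N(d, q, α) such that for every measurable f ≥ 0 on ℝ^{d+1} one has ‖P_α f‖_{L_r(ℝ^{d+1})} ≤ N ‖f‖_{L_q(ℝ^{d+1})}. -/
open MeasureTheory Set ENNReal Filter

noncomputable section

/-- Euclidean space `ℝ^d`. -/
abbrev Ed (d : ℕ) := EuclideanSpace ℝ (Fin d)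

/-- Points of `ℝ^{d+1}`: `z = (t, x)`. -/
abbrev Pt (d : ℕ) := ℝ × Ed d

/-- The parabolic cylinder `C_ρ(t,x)`. -/
def pCyl (d : ℕ) (ρ : ℝ) (z : Pt d) : Set (Pt d) :=
  {w | dist z.2 w.2 < ρ ∧ z.1 ≤ w.1 ∧ w.1 < z.1 + ρ ^ 2}

/-- The average `⨍_{C_ρ(z)} f`. -/
def pAvg (d : ℕ) (ρ : ℝ) (z : Pt d) (f : Pt d → ℝ≥0∞) : ℝ≥0∞ :=
  (volume (pCyl d ρ z))⁻¹ * ∫⁻ w in pCyl d ρ z, f w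

/-- The fractional maximal function `M_β f`. -/
def Mbeta (d : ℕ) (β : ℝ) (f : Pt d → ℝ≥0∞) (z : Pt d) : ℝ≥0∞ :=
  ⨆ (ρ : ℝ) (_ : 0 < ρ), ENNReal.ofReal (ρ ^ β) * pAvg d ρ z f

/-- The kernel `p_α(s, r)`. -/
def pKer (d : ℕ) (α : ℝ) (s r : ℝ) : ℝ≥0∞ :=
  if 0 < s then ENNReal.ofReal (s ^ (-(((d : ℝ) + 2 - α) / 2)) * Real.exp (-(r ^ 2) / s)) else 0

/-- The parabolic potential `P_α f`. -/
def Palpha (d : ℕ) (α : ℝ) (f : Pt d → ℝ≥0∞) (z : Pt d) : ℝ≥0∞ :=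
  ∫⁻ w : Pt d, pKer d α w.1 ‖w.2‖ * f (z.1 + w.1, z.2 + w.2)

/-- The parabolic Morrey norm `‖f‖_{E_{p,β}(Q)}`. -/
def MorreyNorm (d : ℕ) (p β : ℝ) (Q : Set (Pt d)) (f : Pt d → ℝ≥0∞) : ℝ≥0∞ :=
  ⨆ (ρ : ℝ) (_ : 0 < ρ) (z : Pt d) (_ : z ∈ Q),
    ENNReal.ofReal (ρ ^ β) * (pAvg d ρ z fun w => Q.indicator f w ^ p) ^ (1 / p)

/-- The `L_p`-norm on `ℝ^{d+1}`. -/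
def LpNormE (d : ℕ) (p : ℝ) (f : Pt d → ℝ≥0∞) : ℝ≥0∞ :=
  (∫⁻ z : Pt d, f z ^ p) ^ (1 / p)

/-- The mixed norm `‖f‖_{L_{q₁,q₂}}`. -/
def MixedNorm (d : ℕ) (q₁ q₂ : ℝ) (f : Pt d → ℝ≥0∞) : ℝ≥0∞ :=
  (∫⁻ t : ℝ, (∫⁻ x : Ed d, f (t, x) ^ q₁) ^ (q₂ / q₁)) ^ (1 / q₂)

/-- The normalized mixed norm `‖f‖_{L_{q₁,q₂}(Γ)}`. -/
def MixedNormOn (d : ℕ) (q₁ q₂ : ℝ) (Γ : Set (Pt d)) (f : Pt d → ℝ≥0∞) : ℝ≥0∞ :=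
  (MixedNorm d q₁ q₂ (Γ.indicator 1))⁻¹ * MixedNorm d q₁ q₂ (Γ.indicator f)

/-- The mixed-norm parabolic Morrey norm `‖f‖_{E_{q₁,q₂,β}(Q)}`. -/
def MixedMorrey (d : ℕ) (q₁ q₂ β : ℝ) (Q : Set (Pt d)) (f : Pt d → ℝ≥0∞) : ℝ≥0∞ :=
  ⨆ (ρ : ℝ) (_ : 0 < ρ) (z : Pt d) (_ : z ∈ Q),
    ENNReal.ofReal (ρ ^ β) * MixedNormOn d q₁ q₂ (pCyl d ρ z) (Q.indicator f)

/-- The symmetric parabolic maximal function `M̂ f`. -/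
def pMax (d : ℕ) (f : Pt d → ℝ≥0∞) (z : Pt d) : ℝ≥0∞ :=
  ⨆ (r : ℝ) (_ : 0 < r) (w : Pt d) (_ : z ∈ pCyl d r w), pAvg d r w f

/-- The time derivative `∂_t u`. -/
def timeDeriv (d : ℕ) (u : Pt d → ℝ) (z : Pt d) : ℝ :=
  fderiv ℝ u z ((1 : ℝ), (0 : Ed d))

/-- The spatial partial derivative `D_i u`. -/
def spDeriv (d : ℕ) (i : Fin d) (u : Pt d → ℝ) (z : Pt d) : ℝ :=
  fderiv ℝ u z ((0 : ℝ), EuclideanSpace.single i (1 : ℝ))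

/-- The Euclidean norm of the spatial gradient `|Du|`. -/
def gradNorm (d : ℕ) (u : Pt d → ℝ) (z : Pt d) : ℝ :=
  Real.sqrt (∑ i : Fin d, spDeriv d i u z ^ 2)

/-- The spatial Laplacian `Δu`. -/
def lap (d : ℕ) (u : Pt d → ℝ) (z : Pt d) : ℝ :=
  ∑ i : Fin d, spDeriv d i (spDeriv d i u) z

/-- The (Frobenius) norm of the spatial Hessian `|D²u|`. -/
def hessNorm (d : ℕ) (u : Pt d → ℝ) (z : Pt d) : ℝ :=
  Real.sqrt (∑ i : Fin d, ∑ j : Fin d, spDeriv d i (spDeriv d j u) z ^ 2)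



lemma aux_lint_Ioo (p δ : ℝ) (hp : 0 < p) (hδ : 0 ≤ δ) :
    ∫⁻ s in Ioo 0 δ, ENNReal.ofReal (s ^ (p - 1)) = ENNReal.ofReal (δ ^ p / p) := by
  have hi : IntegrableOn (fun s : ℝ => s ^ (p - 1)) (Ioo 0 δ) := by
    have := (intervalIntegral.intervalIntegrable_rpow' (a := 0) (b := δ) (r := p - 1) (by linarith)).1
    exact this.mono_set Ioo_subset_Ioc_self
  rw [← ofReal_integral_eq_lintegral_ofReal hi]
  · rw [← integral_Ioc_eq_integral_Ioo, ← intervalIntegral.integral_of_le hδ,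
      integral_rpow (Or.inl (by linarith))]
    congr 1
    simp [Real.zero_rpow hp.ne']
  · filter_upwards [ae_restrict_mem measurableSet_Ioo] with s hs
    exact Real.rpow_nonneg hs.1.le _

lemma aux_lint_Ici (p δ : ℝ) (hp : 0 < p) (hδ : 0 < δ) :
    ∫⁻ s in Ici δ, ENNReal.ofReal (s ^ (-p - 1)) = ENNReal.ofReal (δ ^ (-p) / p) := by
  have hi : IntegrableOn (fun s : ℝ => s ^ (-p - 1)) (Ioi δ) :=
    integrableOn_Ioi_rpow_of_lt (by linarith) hδ
  rw [setLIntegral_congr Ioi_ae_eq_Ici.symm, ← ofReal_integral_eq_lintegral_ofReal hi]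
  · rw [integral_Ioi_rpow_of_lt (by linarith) hδ]
    congr 1
    rw [show -p - 1 + 1 = -p by ring, neg_div_neg_eq]
  · filter_upwards [ae_restrict_mem measurableSet_Ioi] with s hs
    exact Real.rpow_nonneg (hδ.trans hs).le _

lemma aux_layer (y : ℝ≥0∞) (ρ : ℝ) (hρ : 0 < ρ) :
    ∫⁻ l in Ioi (0 : ℝ), (if ENNReal.ofReal l < y then ENNReal.ofReal (l ^ (ρ - 1)) else 0)
      = y ^ ρ * ENNReal.ofReal ρ⁻¹ := by
  by_cases hy : y = ⊤
  · subst hy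
    simp only [ENNReal.ofReal_lt_top, if_true]
    rw [ENNReal.top_rpow_of_pos hρ, ENNReal.top_mul (by simpa using hρ)]
    by_contra h
    apply not_integrableOn_Ioi_rpow (ρ - 1)
    refine ⟨by fun_prop, ?_⟩
    rw [hasFiniteIntegral_iff_ofReal]
    · exact lt_top_iff_ne_top.2 h
    · filter_upwards [ae_restrict_mem measurableSet_Ioi] with s hs
      exact Real.rpow_nonneg (le_of_lt hs) _
  · have h1 : ∀ l ∈ Ioi (0 : ℝ),
        (if ENNReal.ofReal l < y then ENNReal.ofReal (l ^ (ρ - 1)) else 0)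
        = (Iio y.toReal).indicator (fun l => ENNReal.ofReal (l ^ (ρ - 1))) l := by
      intro l hl
      simp only [indicator, mem_Iio]
      congr 1
      rw [ENNReal.ofReal_lt_iff_lt_toReal (le_of_lt hl) hy]
    rw [setLIntegral_congr_fun measurableSet_Ioi h1, lintegral_indicator measurableSet_Iio,
      Measure.restrict_restrict measurableSet_Iio, inter_comm, Ioi_inter_Iio,
      aux_lint_Ioo _ _ hρ ENNReal.toReal_nonneg, div_eq_mul_inv,
      ENNReal.ofReal_mul (by positivity), ← ENNReal.ofReal_rpow_of_nonneg (by simp) hρ.le,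
      ENNReal.ofReal_toReal hy]

lemma aux_gauss (d : ℕ) (b : ℝ) (hb : 0 < b) :
    ∫⁻ y : Ed d, ENNReal.ofReal (Real.exp (-b * ‖y‖ ^ 2))
      = ENNReal.ofReal ((Real.pi / b) ^ ((d : ℝ) / 2)) := by
  have h := GaussianFourier.integral_rexp_neg_mul_sq_norm (V := Ed d) hb
  have hi : Integrable (fun v : Ed d => Real.exp (-b * ‖v‖ ^ 2)) := by
    by_contra hc
    rw [integral_undef hc] at h
    have : 0 < (Real.pi / b) ^ (Module.finrank ℝ (Ed d) / 2 : ℝ) := by positivity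
    linarith
  rw [← ofReal_integral_eq_lintegral_ofReal hi (Eventually.of_forall fun _ => (Real.exp_pos _).le), h]
  simp

lemma aux_meas_ker (d : ℕ) (α : ℝ) : Measurable (fun w : Pt d => pKer d α w.1 ‖w.2‖) := by
  unfold pKer
  refine Measurable.ite (measurableSet_lt measurable_const measurable_fst) ?_ measurable_const
  fun_prop

lemma aux_meas_cut (d : ℕ) (α : ℝ) (S : Set ℝ) (hS : MeasurableSet S) :
    Measurable (fun w : Pt d => S.indicator (fun _ => pKer d α w.1 ‖w.2‖) w.1) := by
  have : (fun w : Pt d => (S.indicator (fun _ => pKer d α w.1 ‖w.2‖) w.1))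
      = (Prod.fst ⁻¹' S).indicator (fun w : Pt d => pKer d α w.1 ‖w.2‖) := by
    ext w; rfl
  rw [this]
  exact (aux_meas_ker d α).indicator (measurable_fst hS)

lemma aux_kerInt (d : ℕ) (α m : ℝ) (hm : 0 < m) (S : Set ℝ) (hS : MeasurableSet S)
    (hS0 : S ⊆ Ioi 0) :
    ∫⁻ w : Pt d, (S.indicator (fun _ => pKer d α w.1 ‖w.2‖) w.1) ^ m
      = (∫⁻ s in S, ENNReal.ofReal (s ^ (-(((d : ℝ) + 2 - α) / 2) * m + (d : ℝ) / 2)))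
        * ENNReal.ofReal ((Real.pi / m) ^ ((d : ℝ) / 2)) := by
  have hmeas := (aux_meas_cut d α S hS).pow_const m
  rw [Measure.volume_eq_prod, lintegral_prod _ hmeas.aemeasurable,
    ← lintegral_mul_const _ (by fun_prop), ← lintegral_indicator hS]
  apply lintegral_congr
  intro s
  by_cases hs : s ∈ S
  · have hs0 : 0 < s := hS0 hs
    simp only [indicator_of_mem hs, pKer, hs0, if_true]
    have : ∀ y : Ed d, ENNReal.ofReal (s ^ (-(((d : ℝ) + 2 - α) / 2)) * Real.exp (-(‖y‖ ^ 2) / s)) ^ m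
        = ENNReal.ofReal (s ^ (-(((d : ℝ) + 2 - α) / 2) * m))
          * ENNReal.ofReal (Real.exp (-(m / s) * ‖y‖ ^ 2)) := by
      intro y
      rw [ENNReal.ofReal_rpow_of_nonneg (by positivity) hm.le, ← ENNReal.ofReal_mul (by positivity),
        Real.mul_rpow (by positivity) (by positivity), ← Real.rpow_mul hs0.le, ← Real.exp_mul]
      congr 3
      ring
    simp_rw [this]
    rw [lintegral_const_mul _ (by fun_prop), aux_gauss d _ (by positivity),
      ← ENNReal.ofReal_mul (by positivity), ← ENNReal.ofReal_mul (by positivity)]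
    congr 1
    rw [show Real.pi / (m / s) = s * (Real.pi / m) by field_simp,
      Real.mul_rpow hs0.le (by positivity), Real.rpow_add hs0]
    ring
  · simp [indicator_of_notMem hs, ENNReal.zero_rpow_of_pos hm]

lemma aux_inv_left (d : ℕ) : (volume : Measure (Pt d)).IsAddLeftInvariant := by
  rw [Measure.volume_eq_prod]; infer_instance

lemma aux_weak (d : ℕ) (q q' : ℝ) (hqq : q'.HolderConjugate q) (l D : ℝ) (hl : 0 < l) (hD : 0 < D)
    (k kn kf f : Pt d → ℝ≥0∞) (hkn : Measurable kn) (hkf : Measurable kf) (hf : Measurable f)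
    (hk : ∀ w, k w ≤ kn w + kf w) (hn : ∫⁻ w, kn w ≤ ENNReal.ofReal D)
    (hfar : (∫⁻ w, kf w ^ q') ^ (1 / q') ≤ ENNReal.ofReal (l / 2))
    (hf1 : ∫⁻ w, f w ^ q ≤ 1) :
    volume {z : Pt d | ENNReal.ofReal l < ∫⁻ w, k w * f (z + w)}
      ≤ ENNReal.ofReal (l / (4 * D))⁻¹ *
        ∫⁻ z, (if ENNReal.ofReal (l / (4 * D)) < f z then f z else 0) := by
  have := aux_inv_left d
  set a : ℝ := l / (4 * D) with ha
  have ha0 : 0 < a := by positivity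
  set F : Pt d → ℝ≥0∞ := fun z => if ENNReal.ofReal a < f z then f z else 0 with hF
  have hFm : Measurable F := Measurable.ite (measurableSet_lt measurable_const hf) hf measurable_const
  have hfF : ∀ z, f z ≤ F z + ENNReal.ofReal a := by
    intro z
    simp only [hF]
    split_ifs with h
    · exact le_self_add
    · simpa using h
  set g : Pt d → ℝ≥0∞ := fun z => ∫⁻ w, kn w * F (z + w) with hg
  have hjoint : Measurable (fun p : Pt d × Pt d => kn p.2 * F (p.1 + p.2)) := by fun_prop
  have hgm : Measurable g := hjoint.lintegral_prod_right'
  have hgi : ∫⁻ z, g z = (∫⁻ w, kn w) * ∫⁻ z, F z := by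
    simp only [hg]
    rw [lintegral_lintegral_swap hjoint.aemeasurable, ← lintegral_mul_const _ hkn]
    apply lintegral_congr
    intro w
    rw [lintegral_const_mul _ (by fun_prop), lintegral_add_right_eq_self (fun z => F z) w]
  have hfarz : ∀ z, ∫⁻ w, kf w * f (z + w) ≤ ENNReal.ofReal (l / 2) := by
    intro z
    have h1 := ENNReal.lintegral_mul_le_Lp_mul_Lq volume hqq hkf.aemeasurable
      (g := fun w => f (z + w)) (by fun_prop)
    refine h1.trans ?_
    rw [lintegral_add_left_eq_self (fun w => f w ^ q) z]
    refine (mul_le_mul' hfar (ENNReal.rpow_le_one hf1 ?_)).trans (by simp)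
    exact one_div_nonneg.2 hqq.symm.nonneg
  have key : ∀ z, ∫⁻ w, k w * f (z + w) ≤ g z + ENNReal.ofReal (3 * l / 4) := by
    intro z
    calc ∫⁻ w, k w * f (z + w)
        ≤ ∫⁻ w, (kn w * F (z + w) + kn w * ENNReal.ofReal a + kf w * f (z + w)) := by
          apply lintegral_mono
          intro w
          calc k w * f (z + w) ≤ (kn w + kf w) * f (z + w) := by gcongr; exact hk w
            _ = kn w * f (z + w) + kf w * f (z + w) := by ring
            _ ≤ kn w * (F (z + w) + ENNReal.ofReal a) + kf w * f (z + w) := by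
                gcongr; exact hfF _
            _ = _ := by ring
      _ = g z + (∫⁻ w, kn w) * ENNReal.ofReal a + ∫⁻ w, kf w * f (z + w) := by
          rw [lintegral_add_left (by fun_prop), lintegral_add_left (by fun_prop),
            lintegral_mul_const _ hkn]
      _ ≤ g z + ENNReal.ofReal D * ENNReal.ofReal a + ENNReal.ofReal (l / 2) := by
          gcongr; exact hfarz z
      _ = g z + ENNReal.ofReal (3 * l / 4) := by
          rw [add_assoc, ← ENNReal.ofReal_mul hD.le, ← ENNReal.ofReal_add (by positivity) (by positivity)]
          congr 2
          rw [ha]; field_simp; ring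
  calc volume {z : Pt d | ENNReal.ofReal l < ∫⁻ w, k w * f (z + w)}
      ≤ volume {z : Pt d | ENNReal.ofReal (l / 4) ≤ g z} := by
        apply measure_mono
        intro z hz
        simp only [mem_ofPred_eq] at hz ⊢
        by_contra hc
        push Not at hc
        refine absurd hz (not_lt.2 ((key z).trans ?_))
        calc g z + ENNReal.ofReal (3 * l / 4) ≤ ENNReal.ofReal (l / 4) + ENNReal.ofReal (3 * l / 4) := by
              gcongr
          _ = ENNReal.ofReal l := by
              rw [← ENNReal.ofReal_add (by positivity) (by positivity)]; congr 1; ring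
    _ ≤ (∫⁻ z, g z) / ENNReal.ofReal (l / 4) :=
        meas_ge_le_lintegral_div hgm.aemeasurable (by simpa using hl) (by simp)
    _ ≤ (ENNReal.ofReal D * ∫⁻ z, F z) / ENNReal.ofReal (l / 4) := by
        rw [hgi]; gcongr
    _ = ENNReal.ofReal a⁻¹ * ∫⁻ z, F z := by
        rw [div_eq_mul_inv, ← ENNReal.ofReal_inv_of_pos (by positivity), mul_right_comm,
          ← ENNReal.ofReal_mul hD.le]
        congr 2
        rw [ha]; field_simp

lemma aux_young (d : ℕ) (q q' r A : ℝ) (hqq : q'.HolderConjugate q) (hq : 1 < q) (hr0 : 0 < r)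
    (hA : 0 < A)
    (k : Pt d → ℝ≥0∞) (hkm : Measurable k)
    (hk : ∀ l : ℝ, 0 < l → ∃ kn kf : Pt d → ℝ≥0∞, Measurable kn ∧ Measurable kf ∧
      (∀ w, k w ≤ kn w + kf w) ∧ ∫⁻ w, kn w ≤ ENNReal.ofReal (A * l ^ (1 - r / q)) ∧
      (∫⁻ w, kf w ^ q') ^ (1 / q') ≤ ENNReal.ofReal (l / 2)) :
    ∃ C : ℝ, 0 < C ∧ ∀ f : Pt d → ℝ≥0∞, Measurable f → ∫⁻ w, f w ^ q ≤ 1 →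
      ∫⁻ z, (∫⁻ w, k w * f (z + w)) ^ r ≤ ENNReal.ofReal C := by
  have hq0 : 0 < q := by linarith
  set e : ℝ := r / q with he
  have he0 : 0 < e := by positivity
  have hre : 0 < r - e := by
    rw [he, sub_pos, div_lt_iff₀ hq0]; nlinarith
  have hree : 1 / e * (r - e) = q - 1 := by
    rw [he]; field_simp
  set κ : ℝ := 1 / (4 * A) with hκ
  have hκ0 : 0 < κ := by positivity
  refine ⟨r * κ⁻¹ * ((κ⁻¹) ^ (q - 1) * (r - e)⁻¹), by positivity, ?_⟩
  intro f hf hf1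
  set T : Pt d → ℝ≥0∞ := fun z => ∫⁻ w, k w * f (z + w) with hT
  have hTm : Measurable T := by
    have : Measurable (fun p : Pt d × Pt d => k p.2 * f (p.1 + p.2)) := by fun_prop
    exact this.lintegral_prod_right'
  have hweak : ∀ l : ℝ, 0 < l → volume {z | ENNReal.ofReal l < T z}
      ≤ ENNReal.ofReal (κ * l ^ e)⁻¹ * ∫⁻ z, (if ENNReal.ofReal (κ * l ^ e) < f z then f z else 0) := by
    intro l hl
    obtain ⟨kn, kf, h1, h2, h3, h4, h5⟩ := hk l hl
    have := aux_weak d q q' hqq l (A * l ^ (1 - e)) hl (by positivity) k kn kf f h1 h2 hf h3 h4 h5 hf1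
    have hh : l / (4 * (A * l ^ (1 - e))) = κ * l ^ e := by
      rw [hκ, Real.rpow_sub hl, Real.rpow_one]
      have : 0 < l ^ e := by positivity
      field_simp
    rwa [hh] at this
  have hcond : ∀ l : ℝ, 0 < l → ∀ y : ℝ≥0∞, ENNReal.ofReal (κ * l ^ e) < y ↔
      ENNReal.ofReal l < (y * ENNReal.ofReal κ⁻¹) ^ (1 / e) := by
    intro l hl y
    rw [one_div, ENNReal.lt_rpow_inv_iff he0, ENNReal.ofReal_rpow_of_pos hl, ENNReal.ofReal_inv_of_pos hκ0,
      ← div_eq_mul_inv, ENNReal.lt_div_iff_mul_lt (by simp [hκ0]) (by simp), mul_comm,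
      ← ENNReal.ofReal_mul (by positivity)]
  have hm2 : Measurable (fun p : ℝ × Pt d => ENNReal.ofReal (p.1 ^ (r - 1)) *
      (ENNReal.ofReal (κ * p.1 ^ e)⁻¹ * (if ENNReal.ofReal (κ * p.1 ^ e) < f p.2 then f p.2 else 0))) := by
    have : Measurable (fun p : ℝ × Pt d => (if ENNReal.ofReal (κ * p.1 ^ e) < f p.2 then f p.2 else 0)) :=
      Measurable.ite (measurableSet_lt (by fun_prop) (by fun_prop)) (by fun_prop) measurable_const
    fun_prop
  have hm1 : Measurable (fun p : Pt d × ℝ =>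
      (if ENNReal.ofReal p.2 < T p.1 then ENNReal.ofReal (p.2 ^ (r - 1)) else 0)) :=
    Measurable.ite (measurableSet_lt (by fun_prop) (by fun_prop)) (by fun_prop) measurable_const
  have step1 : (∫⁻ z, T z ^ r) * ENNReal.ofReal r⁻¹
      = ∫⁻ l in Ioi (0:ℝ), ENNReal.ofReal (l ^ (r - 1)) * volume {z | ENNReal.ofReal l < T z} := by
    rw [← lintegral_mul_const _ (by fun_prop)]
    simp_rw [← aux_layer _ r hr0]
    rw [lintegral_lintegral_swap hm1.aemeasurable]
    apply lintegral_congr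
    intro l
    rw [← lintegral_indicator_const (measurableSet_lt measurable_const hTm)]
    apply lintegral_congr
    intro z
    simp [indicator]
  have step2 : (∫⁻ z, T z ^ r) * ENNReal.ofReal r⁻¹
      ≤ ENNReal.ofReal (κ⁻¹ * ((κ⁻¹) ^ (q - 1) * (r - e)⁻¹)) := by
    rw [step1]
    calc ∫⁻ l in Ioi (0:ℝ), ENNReal.ofReal (l ^ (r - 1)) * volume {z | ENNReal.ofReal l < T z}
        ≤ ∫⁻ l in Ioi (0:ℝ), ∫⁻ z, ENNReal.ofReal (l ^ (r - 1)) *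
          (ENNReal.ofReal (κ * l ^ e)⁻¹ * (if ENNReal.ofReal (κ * l ^ e) < f z then f z else 0)) := by
          apply setLIntegral_mono' measurableSet_Ioi
          intro l hl
          have hmi : Measurable (fun z => (if ENNReal.ofReal (κ * l ^ e) < f z then f z else 0)) :=
            Measurable.ite (measurableSet_lt measurable_const hf) hf measurable_const
          rw [lintegral_const_mul _ (by fun_prop), lintegral_const_mul _ hmi]
          gcongr
          exact hweak l hl
      _ = ∫⁻ z, ∫⁻ l in Ioi (0:ℝ), ENNReal.ofReal (l ^ (r - 1)) *
          (ENNReal.ofReal (κ * l ^ e)⁻¹ * (if ENNReal.ofReal (κ * l ^ e) < f z then f z else 0)) :=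
          lintegral_lintegral_swap hm2.aemeasurable
      _ = ∫⁻ z, (ENNReal.ofReal κ⁻¹ * f z) * ((f z * ENNReal.ofReal κ⁻¹) ^ (q - 1) *
            ENNReal.ofReal (r - e)⁻¹) := by
          apply lintegral_congr
          intro z
          rw [← hree, ENNReal.rpow_mul, ← aux_layer _ _ hre, ← lintegral_const_mul]
          · apply setLIntegral_congr_fun measurableSet_Ioi
            intro l hl
            have hl : 0 < l := hl
            simp only [← hcond l hl]
            split_ifs
            · have : l ^ (r - e - 1) = l ^ (r - 1) * (l ^ e)⁻¹ := by
                rw [← Real.rpow_neg hl.le, ← Real.rpow_add hl]; congr 1; ring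
              rw [this, mul_inv, ENNReal.ofReal_mul (by positivity), ENNReal.ofReal_mul (by positivity)]
              ring
            · simp
          · exact Measurable.ite (measurableSet_lt (by fun_prop) (by fun_prop)) (by fun_prop)
              measurable_const
      _ = ENNReal.ofReal (κ⁻¹ * ((κ⁻¹) ^ (q - 1) * (r - e)⁻¹)) * ∫⁻ z, f z ^ q := by
          rw [← lintegral_const_mul _ (by fun_prop)]
          apply lintegral_congr
          intro z
          have hfq : f z ^ q = f z * f z ^ (q - 1) := by
            conv_lhs => rw [show q = 1 + (q - 1) by ring]
            rw [ENNReal.rpow_add_of_nonneg _ _ zero_le_one (by linarith), ENNReal.rpow_one]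
          rw [hfq, ENNReal.mul_rpow_of_nonneg _ _ (by linarith : 0 ≤ q - 1),
            ENNReal.ofReal_mul (by positivity), ENNReal.ofReal_mul (by positivity),
            ENNReal.ofReal_rpow_of_nonneg (by positivity) (by linarith)]
          ring
      _ ≤ _ := by
          refine (mul_le_mul' le_rfl hf1).trans (by simp)
  calc ∫⁻ z, T z ^ r = ((∫⁻ z, T z ^ r) * ENNReal.ofReal r⁻¹) * ENNReal.ofReal r := by
        rw [mul_assoc, ← ENNReal.ofReal_mul (by positivity), inv_mul_cancel₀ hr0.ne']; simp
    _ ≤ _ := mul_le_mul' step2 le_rfl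
    _ = _ := by
        rw [← ENNReal.ofReal_mul (by positivity)]; congr 1; ring

theorem stmt3 (d : ℕ) (hd : 1 ≤ d) (q α r : ℝ) (hq : 1 < q)
    (hα : 0 < α) (hαq : α < ((d : ℝ) + 2) / q)
    (hr : ((d : ℝ) + 2) / q - α = ((d : ℝ) + 2) / r) :
    ∃ N : ℝ, 0 < N ∧ ∀ f : Pt d → ℝ≥0∞, Measurable f →
      LpNormE d r (Palpha d α f) ≤ ENNReal.ofReal N * LpNormE d q f := by
  have := aux_inv_left d
  have hq0 : 0 < q := by linarith
  have hn : (0 : ℝ) < (d : ℝ) + 2 := by positivity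
  have hr0 : 0 < r := by
    by_contra h
    have : ((d : ℝ) + 2) / r ≤ 0 := div_nonpos_of_nonneg_of_nonpos hn.le (not_lt.1 h)
    linarith
  have hαeq : α / ((d : ℝ) + 2) = 1 / q - 1 / r := by
    field_simp at hr ⊢
    linarith
  set q' : ℝ := q.conjExponent with hq'
  have hqq : q'.HolderConjugate q := (Real.HolderConjugate.conjExponent hq).symm
  have hq'0 : 0 < q' := hqq.pos
  have hinv : 1 / q' = 1 - 1 / q := by
    have := hqq.inv_add_inv_eq_one
    simp only [one_div]; linarith
  set E : ℝ := ((d : ℝ) + 2) / (2 * r) with hE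
  have hE0 : 0 < E := by positivity
  set A : ℝ := 2 / α * (Real.pi / 1) ^ ((d : ℝ) / 2) with hA
  have hA0 : 0 < A := by positivity
  set B : ℝ := ((E * q')⁻¹ * (Real.pi / q') ^ ((d : ℝ) / 2)) ^ (1 / q') with hB
  have hB0 : 0 < B := by positivity
  have hnear : ∀ δ : ℝ, 0 < δ →
      ∫⁻ w : Pt d, (Ioo 0 δ).indicator (fun _ => pKer d α w.1 ‖w.2‖) w.1
        = ENNReal.ofReal (A * δ ^ (α / 2)) := by
    intro δ hδ
    have := aux_kerInt d α 1 one_pos (Ioo 0 δ) measurableSet_Ioo (fun x hx => hx.1)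
    simp only [ENNReal.rpow_one] at this
    rw [this, show -(((d : ℝ) + 2 - α) / 2) * 1 + (d : ℝ) / 2 = α / 2 - 1 by ring,
      aux_lint_Ioo _ _ (by positivity) hδ.le, ← ENNReal.ofReal_mul (by positivity)]
    congr 1
    rw [hA]; field_simp
  have hfar : ∀ δ : ℝ, 0 < δ →
      (∫⁻ w : Pt d, ((Ici δ).indicator (fun _ => pKer d α w.1 ‖w.2‖) w.1) ^ q') ^ (1 / q')
        = ENNReal.ofReal (B * δ ^ (-E)) := by
    intro δ hδ
    have hexp : -(((d : ℝ) + 2 - α) / 2) * q' + (d : ℝ) / 2 = -(E * q') - 1 := by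
      have h1 : E = ((d : ℝ) + 2) / (2 * q) - α / 2 := by
        rw [hE]
        field_simp at hr ⊢
        linarith
      have h2 : q' = 1 + q' / q := by
        field_simp at hinv ⊢
        linarith
      have h3 : q' / q = q' - 1 := by linarith
      rw [h1]
      have h4 : ((d : ℝ) + 2) / (2 * q) * q' = ((d : ℝ) + 2) / 2 * (q' / q) := by
        field_simp
      rw [sub_mul, h4, h3]
      ring
    rw [aux_kerInt d α q' hq'0 (Ici δ) measurableSet_Ici (fun x hx => lt_of_lt_of_le hδ hx), hexp,
      aux_lint_Ici _ _ (by positivity) hδ, ← ENNReal.ofReal_mul (by positivity),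
      ENNReal.ofReal_rpow_of_nonneg (by positivity) (by positivity)]
    congr 1
    rw [hB, show δ ^ (-E) = (δ ^ (-(E * q'))) ^ (1 / q') by
      rw [← Real.rpow_mul hδ.le]; congr 1; field_simp, ← Real.mul_rpow (by positivity) (by positivity)]
    congr 1
    field_simp
  obtain ⟨C, hC0, hC⟩ := aux_young d q q' r (A * (2 * B) ^ (r / q - 1)) hqq hq hr0 (by positivity)
    (fun w => pKer d α w.1 ‖w.2‖) (aux_meas_ker d α) (by
      intro l hl
      set δ : ℝ := (2 * B / l) ^ (1 / E) with hδ
      have hδ0 : 0 < δ := by positivity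
      refine ⟨_, _, aux_meas_cut d α (Ioo 0 δ) measurableSet_Ioo,
        aux_meas_cut d α (Ici δ) measurableSet_Ici, ?_, ?_, ?_⟩
      · intro w
        by_cases h0 : 0 < w.1
        · by_cases h1 : w.1 < δ
          · rw [indicator_of_mem (show w.1 ∈ Ioo 0 δ from ⟨h0, h1⟩)]
            exact le_self_add
          · rw [indicator_of_mem (show w.1 ∈ Ici δ from not_lt.1 h1)]
            exact le_add_self
        · simp [pKer, h0]
      · rw [hnear δ hδ0]
        apply le_of_eq
        congr 1
        rw [hδ, ← Real.rpow_mul (by positivity)]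
        have : 1 / E * (α / 2) = r / q - 1 := by
          rw [hE]
          have : α = (1 / q - 1 / r) * ((d : ℝ) + 2) := by rw [← hαeq]; field_simp
          rw [this]; field_simp
        rw [this, Real.div_rpow (by positivity) hl.le, show 1 - r / q = -(r / q - 1) by ring,
          Real.rpow_neg hl.le]
        ring
      · rw [hfar δ hδ0]
        apply le_of_eq
        congr 1
        rw [hδ, ← Real.rpow_mul (by positivity), show 1 / E * -E = -1 by field_simp,
          Real.rpow_neg_one]
        field_simp)
  refine ⟨C ^ (1 / r), by positivity, ?_⟩
  intro f hf
  have hmain : ∀ g : Pt d → ℝ≥0∞, Measurable g → ∫⁻ w, g w ^ q ≤ 1 →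
      LpNormE d r (Palpha d α g) ≤ ENNReal.ofReal (C ^ (1 / r)) := by
    intro g hg hg1
    unfold LpNormE
    rw [← ENNReal.ofReal_rpow_of_nonneg hC0.le (by positivity)]
    exact ENNReal.rpow_le_rpow (hC g hg hg1) (by positivity)
  set M := LpNormE d q f with hM
  have hMq : M ^ q = ∫⁻ w, f w ^ q := by
    rw [hM, LpNormE, ← ENNReal.rpow_mul, one_div_mul_cancel hq0.ne', ENNReal.rpow_one]
  by_cases hM0 : M = 0
  · have h0 : ∫⁻ w, f w ^ q = 0 := by rw [← hMq, hM0, ENNReal.zero_rpow_of_pos hq0]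
    rw [lintegral_eq_zero_iff (by fun_prop)] at h0
    have hf0 : ∀ᵐ w, f w = 0 := by
      filter_upwards [h0] with w hw
      simpa [hq0, hq0.le, not_lt.2 hq0.le] using hw
    have hP : ∀ z, Palpha d α f z = 0 := by
      intro z
      have : ∀ᵐ w, f (z + w) = 0 := (measurePreserving_add_left volume z).quasiMeasurePreserving.ae hf0
      unfold Palpha
      rw [← lintegral_zero (μ := (volume : Measure (Pt d)))]
      apply lintegral_congr_ae
      filter_upwards [this] with w hw
      have hw' : f (z.1 + w.1, z.2 + w.2) = 0 := hw
      rw [hw', mul_zero]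
    simp [LpNormE, hP, hr0]
  by_cases hMt : M = ⊤
  · rw [hMt, ENNReal.mul_top]
    · exact le_top
    · simp; positivity
  have hg1 : ∫⁻ w, (M⁻¹ * f w) ^ q ≤ 1 := by
    simp_rw [ENNReal.mul_rpow_of_nonneg _ _ hq0.le]
    rw [lintegral_const_mul _ (by fun_prop), ← hMq, ← ENNReal.mul_rpow_of_nonneg _ _ hq0.le,
      ENNReal.inv_mul_cancel hM0 hMt, ENNReal.one_rpow]
  have h := hmain (fun w => M⁻¹ * f w) (by fun_prop) hg1
  have hPm : Measurable (Palpha d α f) := by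
    have : Measurable (fun p : Pt d × Pt d => pKer d α p.2.1 ‖p.2.2‖ * f (p.1 + p.2)) :=
      ((aux_meas_ker d α).comp measurable_snd).mul (by fun_prop)
    exact this.lintegral_prod_right'
  have hPs : ∀ z, Palpha d α (fun w => M⁻¹ * f w) z = M⁻¹ * Palpha d α f z := by
    intro z
    unfold Palpha
    rw [← lintegral_const_mul']
    · apply lintegral_congr; intro w; ring
    · simpa using hM0
  have hLs : LpNormE d r (Palpha d α (fun w => M⁻¹ * f w)) = M⁻¹ * LpNormE d r (Palpha d α f) := by
    unfold LpNormE
    simp_rw [hPs, ENNReal.mul_rpow_of_nonneg _ _ hr0.le]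
    rw [lintegral_const_mul _ (by fun_prop), ENNReal.mul_rpow_of_nonneg _ _ (by positivity),
      ← ENNReal.rpow_mul, mul_one_div_cancel hr0.ne', ENNReal.rpow_one]
  rw [hLs] at h
  calc LpNormE d r (Palpha d α f) = M * (M⁻¹ * LpNormE d r (Palpha d α f)) := by
        rw [← mul_assoc, ENNReal.mul_inv_cancel hM0 hMt, one_mul]
    _ ≤ M * ENNReal.ofReal (C ^ (1 / r)) := by gcongr
    _ = _ := mul_comm _ _
end
end

section
/- Let d ≥ 1, 1 < q < d+2, and let r satisfy (d+2)/q − 1 = (d+2)/r. Then there exists a constant N = N(d, q) such that for every u ∈ C_0^∞(ℝ^{d+1}) one has ‖Du‖_{L_r(ℝ^{d+1})} ≤ N ‖∂_t u + Δu‖_{L_q(ℝ^{d+1})}. -/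
open MeasureTheory Set ENNReal Filter

noncomputable section

/-! ### Gaussian weights -/

lemma ga_integrable (d : ℕ) {b : ℝ} (hb : 0 < b) :
    Integrable (fun η : Ed d => Real.exp (-b * ‖η‖ ^ 2)) := by
  have h := GaussianFourier.integrable_cexp_neg_mul_sq_norm_add (b := (b : ℂ)) (V := Ed d)
    (by simpa using hb) 0 0
  have h2 := h.norm
  refine h2.congr (Eventually.of_forall fun η => ?_)
  simp only [Complex.norm_exp]
  congr 1
  simp [← Complex.ofReal_pow]

/-- The Gaussian weight. -/
def gaG (d : ℕ) (η : Ed d) : ℝ := Real.exp (-(1 / 4) * ‖η‖ ^ 2)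

lemma gaG_cont (d : ℕ) : Continuous (gaG d) := by unfold gaG; fun_prop

lemma gaG_nonneg (d : ℕ) (η : Ed d) : 0 ≤ gaG d η := (Real.exp_pos _).le

lemma gaG_int (d : ℕ) : Integrable (gaG d) := ga_integrable d (by norm_num)

lemma gaG_Z_pos (d : ℕ) : 0 < ∫ η, gaG d η := by
  unfold gaG
  rw [GaussianFourier.integral_rexp_neg_mul_sq_norm (by norm_num)]
  positivity

lemma gaG_norm_le (d : ℕ) (η : Ed d) :
    ‖η‖ * gaG d η ≤ 2 * Real.exp (-(1 / 8) * ‖η‖ ^ 2) := by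
  have h1 : gaG d η = Real.exp (-(1 / 8) * ‖η‖ ^ 2) * Real.exp (-(1 / 8) * ‖η‖ ^ 2) := by
    unfold gaG; rw [← Real.exp_add]; congr 1; ring
  have h2 : ‖η‖ * Real.exp (-(1 / 8) * ‖η‖ ^ 2) ≤ 2 := by
    have h3 := Real.add_one_le_exp ((1 / 8) * ‖η‖ ^ 2)
    have h4 : Real.exp (-(1 / 8) * ‖η‖ ^ 2) * Real.exp ((1 / 8) * ‖η‖ ^ 2) = 1 := by
      rw [← Real.exp_add]; simp
    have h5 := Real.exp_pos (-(1 / 8) * ‖η‖ ^ 2)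
    have h6 : ‖η‖ ≤ 2 * Real.exp ((1 / 8) * ‖η‖ ^ 2) := by nlinarith [sq_nonneg (‖η‖ - 2)]
    nlinarith [mul_le_mul_of_nonneg_right h6 h5.le]
  rw [h1, ← mul_assoc]
  exact mul_le_mul_of_nonneg_right h2 (Real.exp_pos _).le

lemma gaG_norm_int (d : ℕ) : Integrable (fun η => ‖η‖ * gaG d η) := by
  refine ((ga_integrable d (b := 1 / 8) (by norm_num)).const_mul 2).mono'
    ((continuous_norm.mul (gaG_cont d)).aestronglyMeasurable) (Eventually.of_forall fun η => ?_)
  rw [Real.norm_of_nonneg (mul_nonneg (norm_nonneg _) (gaG_nonneg d η))]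
  exact gaG_norm_le d η

lemma gaG_hasFDerivAt (d : ℕ) (η : Ed d) :
    HasFDerivAt (gaG d) ((gaG d η * -(1 / 2)) • (innerSL ℝ η)) η := by
  have h := ((hasStrictFDerivAt_norm_sq η).hasFDerivAt.const_mul (-(1 / 4) : ℝ)).exp
  refine h.congr_fderiv ?_
  ext v
  simp [gaG]
  ring

lemma gaG_fderiv (d : ℕ) (η : Ed d) (j : Fin d) :
    fderiv ℝ (gaG d) η (EuclideanSpace.single j 1) = -(1 / 2) * (η j * gaG d η) := by
  rw [(gaG_hasFDerivAt d η).fderiv]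
  simp [EuclideanSpace.inner_single_right]
  ring

lemma coord_le (d : ℕ) (η : Ed d) (j : Fin d) : |η j| ≤ ‖η‖ := by
  simpa using PiLp.norm_apply_le η j

/-- integrability against the Gaussian -/
lemma gaG_mul_int (d : ℕ) {φ : Ed d → ℝ} (hφ : Continuous φ) {B : ℝ} (hB : ∀ η, |φ η| ≤ B) :
    Integrable (fun η => gaG d η * φ η) :=
  (gaG_int d).mul_bdd (c := B) hφ.aestronglyMeasurable (Eventually.of_forall hB)

lemma gaG_coord_mul_int (d : ℕ) (j : Fin d) {φ : Ed d → ℝ} (hφ : Continuous φ) {B : ℝ}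
    (hB : ∀ η, |φ η| ≤ B) :
    Integrable (fun η => (η j * gaG d η) * φ η) := by
  refine Integrable.mul_bdd (c := B) ?_ hφ.aestronglyMeasurable (Eventually.of_forall hB)
  refine (gaG_norm_int d).mono' ?_ (Eventually.of_forall fun η => ?_)
  · exact Continuous.aestronglyMeasurable (by have := gaG_cont d; fun_prop)
  · rw [norm_mul, Real.norm_of_nonneg (gaG_nonneg d η)]
    exact mul_le_mul_of_nonneg_right (coord_le d η j) (gaG_nonneg d η)

lemma gaG_ibp (d : ℕ) (j : Fin d) {φ : Ed d → ℝ} (hφ : ContDiff ℝ 1 φ) {B : ℝ}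
    (hB : ∀ η, |φ η| ≤ B) (hB' : ∀ η, |fderiv ℝ φ η (EuclideanSpace.single j 1)| ≤ B) :
    ∫ η, (η j * gaG d η) * φ η = 2 * ∫ η, gaG d η * fderiv ℝ φ η (EuclideanSpace.single j 1) := by
  have hc : Continuous fun η => fderiv ℝ φ η (EuclideanSpace.single j 1) :=
    (hφ.continuous_fderiv (by norm_num)).clm_apply continuous_const
  have h := integral_mul_fderiv_eq_neg_fderiv_mul_of_integrable (μ := volume) (f := gaG d) (g := φ)
    (v := EuclideanSpace.single j (1 : ℝ)) ?_ (gaG_mul_int d hc hB')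
    (gaG_mul_int d hφ.continuous hB)
    (fun x _ => (gaG_hasFDerivAt d x).differentiableAt)
    (fun x _ => hφ.differentiable (by norm_num) x)
  · rw [h]
    simp only [gaG_fderiv]
    rw [← integral_neg, ← integral_const_mul]
    congr 1; ext η; ring
  · simp only [gaG_fderiv]
    have := (gaG_coord_mul_int d j hφ.continuous hB).const_mul (-(1 / 2))
    refine this.congr (Eventually.of_forall fun η => ?_)
    simp only; ring

/-! ### smooth compactly supported functions -/

/-- smooth with compact support -/
def Ccs (d : ℕ) (u : Pt d → ℝ) : Prop := ContDiff ℝ (⊤ : ℕ∞) u ∧ HasCompactSupport u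

lemma Ccs.fderiv_apply {d : ℕ} {u : Pt d → ℝ} (h : Ccs d u) (v : Pt d) :
    Ccs d (fun z => fderiv ℝ u z v) := by
  refine ⟨(h.1.fderiv_right (m := (⊤ : ℕ∞)) (by simp)).clm_apply contDiff_const, ?_⟩
  exact h.2.fderiv_apply (𝕜 := ℝ) v

lemma Ccs.bdd {d : ℕ} {u : Pt d → ℝ} (h : Ccs d u) : ∃ B, ∀ z, |u z| ≤ B :=
  h.2.exists_bound_of_continuous h.1.continuous

lemma Ccs.bdd_fderiv {d : ℕ} {u : Pt d → ℝ} (h : Ccs d u) : ∃ B, ∀ z, ‖fderiv ℝ u z‖ ≤ B :=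
  (h.2.fderiv (𝕜 := ℝ)).exists_bound_of_continuous (h.1.continuous_fderiv (by simp))

lemma Ccs.add {d : ℕ} {u v : Pt d → ℝ} (h : Ccs d u) (h' : Ccs d v) :
    Ccs d (fun z => u z + v z) := ⟨h.1.add h'.1, h.2.add h'.2⟩

lemma Ccs.sum {d : ℕ} {ι : Type*} (s : Finset ι) {u : ι → Pt d → ℝ} (h : ∀ i, Ccs d (u i)) :
    Ccs d (fun z => ∑ i ∈ s, u i z) := by
  classical
  induction s using Finset.induction_on with
  | empty => simpa using ⟨contDiff_const, HasCompactSupport.zero⟩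
  | insert a s ha ih =>
    simp only [Finset.sum_insert ha]
    exact (h a).add ih

lemma Ccs.sp {d : ℕ} {u : Pt d → ℝ} (h : Ccs d u) (i : Fin d) : Ccs d (spDeriv d i u) :=
  h.fderiv_apply _

lemma Ccs.tm {d : ℕ} {u : Pt d → ℝ} (h : Ccs d u) : Ccs d (timeDeriv d u) :=
  h.fderiv_apply _

lemma Ccs.lap {d : ℕ} {u : Pt d → ℝ} (h : Ccs d u) : Ccs d (lap d u) :=
  Ccs.sum _ fun i => (h.sp i).sp i

/-- derivatives commute -/
lemma Ccs.comm {d : ℕ} {u : Pt d → ℝ} (h : Ccs d u) (v w : Pt d) (z : Pt d) :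
    fderiv ℝ (fun y => fderiv ℝ u y v) z w = fderiv ℝ (fun y => fderiv ℝ u y w) z v := by
  have hd : DifferentiableAt ℝ (fderiv ℝ u) z :=
    ((h.1.fderiv_right (m := (⊤ : ℕ∞)) (by simp)).differentiable (by simp)) z
  have hs := (h.1.contDiffAt (x := z)).isSymmSndFDerivAt (by
    simp only [minSmoothness_of_isRCLikeNormedField]; exact WithTop.coe_le_coe.2 (le_top (a := (2 : ℕ∞))))
  have h1 : ∀ v w : Pt d, fderiv ℝ (fun y => fderiv ℝ u y v) z w = fderiv ℝ (fderiv ℝ u) z w v := by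
    intro v w
    rw [fderiv_clm_apply hd (differentiableAt_const v)]
    simp
  rw [h1, h1]
  exact hs w v

lemma Ccs.sp_comm {d : ℕ} {u : Pt d → ℝ} (h : Ccs d u) (i : Fin d) (z : Pt d) :
    spDeriv d i (fun z => timeDeriv d u z + _root_.lap d u z) z
      = timeDeriv d (spDeriv d i u) z + _root_.lap d (spDeriv d i u) z := by
  have e1 : spDeriv d i (fun z => timeDeriv d u z + _root_.lap d u z) z
      = spDeriv d i (timeDeriv d u) z + spDeriv d i (_root_.lap d u) z := by
    unfold spDeriv
    have := fderiv_fun_add (𝕜 := ℝ) (f := timeDeriv d u) (g := _root_.lap d u) (x := z)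
      (h.tm.1.differentiable (by simp) z) (h.lap.1.differentiable (by simp) z)
    rw [this]; rfl
  have e2 : spDeriv d i (_root_.lap d u) z = ∑ j, spDeriv d i (spDeriv d j (spDeriv d j u)) z := by
    have : _root_.lap d u = fun z => ∑ j, spDeriv d j (spDeriv d j u) z := rfl
    rw [this]
    change fderiv ℝ (fun z => ∑ j, spDeriv d j (spDeriv d j u) z) z _ = _
    rw [fderiv_fun_sum fun j _ => (((h.sp j).sp j).1.differentiable (by simp) z)]
    simp [spDeriv]
  rw [e1, e2]
  congr 1
  · exact h.comm _ _ z
  · unfold _root_.lap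
    refine Finset.sum_congr rfl fun j _ => ?_
    have c1 : spDeriv d i (spDeriv d j (spDeriv d j u)) z
      = spDeriv d j (spDeriv d i (spDeriv d j u)) z := (h.sp j).comm _ _ z
    have c2 : spDeriv d i (spDeriv d j u) = spDeriv d j (spDeriv d i u) := by
      ext y; exact h.comm _ _ y
    rw [c1, c2]

/-! ### the representation formula -/

lemma slice_fderiv {d : ℕ} {ψ : Pt d → ℝ} (h : Ccs d ψ) (τ σ : ℝ) (x η v : Ed d) :
    fderiv ℝ (fun η : Ed d => ψ (τ, x + σ • η)) η v = σ * fderiv ℝ ψ (τ, x + σ • η) (0, v) := by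
  have h1 : HasFDerivAt (fun η : Ed d => (τ, x + σ • η))
      ((0 : Ed d →L[ℝ] ℝ).prod (σ • ContinuousLinearMap.id ℝ (Ed d))) η :=
    (hasFDerivAt_const τ η).prodMk (((hasFDerivAt_id η).const_smul σ).const_add x)
  have h2 : HasFDerivAt ψ (fderiv ℝ ψ (τ, x + σ • η)) (τ, x + σ • η) :=
    (h.1.differentiable (by simp) _).hasFDerivAt
  have h3 := (h2.comp η h1).fderiv
  have h4 : ((0 : ℝ), σ • v) = σ • ((0 : ℝ), v) := by simp
  change fderiv ℝ (ψ ∘ fun η : Ed d => (τ, x + σ • η)) η v = _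
  rw [h3]
  simp [h4, -Prod.smul_mk]

lemma slice_ibp {d : ℕ} {ψ : Pt d → ℝ} (h : Ccs d ψ) (τ σ : ℝ) (x : Ed d) (j : Fin d) :
    ∫ η, (η j * gaG d η) * ψ (τ, x + σ • η)
      = 2 * σ * ∫ η, gaG d η * spDeriv d j ψ (τ, x + σ • η) := by
  obtain ⟨B1, hB1⟩ := h.bdd
  obtain ⟨B2, hB2⟩ := (h.sp j).bdd
  have hB2' : 0 ≤ B2 := (abs_nonneg _).trans (hB2 0)
  have := gaG_ibp d j (φ := fun η : Ed d => ψ (τ, x + σ • η)) (B := max B1 (|σ| * B2))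
    ((h.1.of_le (by exact_mod_cast le_top)).comp (by fun_prop))
    (fun η => (hB1 _).trans (le_max_left _ _))
    (fun η => by
      rw [slice_fderiv h, abs_mul]
      exact (mul_le_mul_of_nonneg_left (hB2 _) (abs_nonneg _)).trans (le_max_right _ _))
  rw [this]
  simp only [slice_fderiv h]
  rw [mul_assoc]
  congr 1
  rw [← integral_const_mul]
  congr 1; ext η; unfold spDeriv; ring

lemma slice_int {d : ℕ} {ψ : Pt d → ℝ} (h : Ccs d ψ) (τ σ : ℝ) (x : Ed d) :
    Integrable fun η => gaG d η * ψ (τ, x + σ • η) := by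
  obtain ⟨B1, hB1⟩ := h.bdd
  exact gaG_mul_int d (h.1.continuous.comp (by fun_prop)) (fun η => hB1 _)

lemma slice_int' {d : ℕ} {ψ : Pt d → ℝ} (h : Ccs d ψ) (τ σ : ℝ) (x : Ed d) (j : Fin d) :
    Integrable fun η => (η j * gaG d η) * ψ (τ, x + σ • η) := by
  obtain ⟨B1, hB1⟩ := h.bdd
  exact gaG_coord_mul_int d j (h.1.continuous.comp (by fun_prop)) (fun η => hB1 _)

lemma fderiv_split {d : ℕ} {w : Pt d → ℝ} (z : Pt d) (a : ℝ) (η : Ed d) :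
    fderiv ℝ w z (a, η) = a * timeDeriv d w z + ∑ j, η j * spDeriv d j w z := by
  have h1 : ((a, η) : Pt d) = a • ((1 : ℝ), (0 : Ed d))
      + ∑ j, η j • ((0 : ℝ), EuclideanSpace.single j (1 : ℝ)) := by
    refine Prod.ext ?_ ?_
    · simp [Prod.fst_sum]
    · ext k
      simp [Prod.snd_sum, Pi.single_apply]
  rw [h1, map_add, map_smul, map_sum]
  simp only [map_smul, smul_eq_mul, timeDeriv, spDeriv]

lemma H_deriv {d : ℕ} {w : Pt d → ℝ} (h : Ccs d w) (t : ℝ) (x : Ed d) (σ : ℝ) :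
    HasDerivAt (fun σ => ∫ η, gaG d η * w (t + σ ^ 2, x + σ • η))
      (2 * σ * ∫ η, gaG d η * (timeDeriv d w (t + σ ^ 2, x + σ • η)
        + lap d w (t + σ ^ 2, x + σ • η))) σ := by
  obtain ⟨B, hB⟩ := h.bdd_fderiv
  have hB0 : 0 ≤ B := (norm_nonneg _).trans (hB 0)
  have hc := gaG_cont d
  have hw := h.1.continuous
  have hfw : Continuous (fderiv ℝ w) := h.1.continuous_fderiv (by simp)
  have key := hasDerivAt_integral_of_dominated_loc_of_deriv_le (μ := (volume : Measure (Ed d)))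
    (F := fun σ η => gaG d η * w (t + σ ^ 2, x + σ • η)) (x₀ := σ) (s := Metric.ball σ 1)
    (F' := fun σ η => gaG d η * fderiv ℝ w (t + σ ^ 2, x + σ • η) (2 * σ, η))
    (bound := fun η => B * (2 * (|σ| + 1)) * gaG d η + B * (‖η‖ * gaG d η))
    (Metric.ball_mem_nhds σ one_pos)
    (Eventually.of_forall fun σ => Continuous.aestronglyMeasurable (by fun_prop))
    (slice_int h _ _ _)
    (Continuous.aestronglyMeasurable (by fun_prop))
    ?_ (((gaG_int d).const_mul _).add ((gaG_norm_int d).const_mul _)) ?_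
  · refine key.2.congr_deriv ?_
    have e : ∀ η : Ed d, gaG d η * fderiv ℝ w (t + σ ^ 2, x + σ • η) (2 * σ, η)
        = 2 * σ * (gaG d η * timeDeriv d w (t + σ ^ 2, x + σ • η))
          + ∑ j, (η j * gaG d η) * spDeriv d j w (t + σ ^ 2, x + σ • η) := by
      intro η
      rw [fderiv_split, mul_add, Finset.mul_sum]
      congr 1
      · ring
      · exact Finset.sum_congr rfl fun j _ => by ring
    simp only [e]
    rw [integral_add ((slice_int h.tm _ _ _).const_mul _)
      (integrable_finsetSum _ fun j _ => slice_int' (h.sp j) _ _ _ j),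
      integral_finsetSum _ fun j _ => slice_int' (h.sp j) _ _ _ j]
    have e3 : ∀ j, ∫ η, (η j * gaG d η) * spDeriv d j w (t + σ ^ 2, x + σ • η)
        = 2 * σ * ∫ η, gaG d η * spDeriv d j (spDeriv d j w) (t + σ ^ 2, x + σ • η) :=
      fun j => slice_ibp (h.sp j) _ _ _ j
    simp only [e3]
    simp only [mul_add]
    rw [integral_add (slice_int h.tm _ _ _) (slice_int h.lap _ _ _), mul_add,
      integral_const_mul, ← Finset.mul_sum]
    have e2 : ∫ η, gaG d η * lap d w (t + σ ^ 2, x + σ • η)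
        = ∑ j, ∫ η, gaG d η * spDeriv d j (spDeriv d j w) (t + σ ^ 2, x + σ • η) := by
      simp only [lap, Finset.mul_sum]
      exact integral_finsetSum _ fun j _ => slice_int ((h.sp j).sp j) _ _ _
    rw [e2]
  · refine Eventually.of_forall fun η s hs => ?_
    rw [norm_mul, Real.norm_of_nonneg (gaG_nonneg d η)]
    have h1 : |s| ≤ |σ| + 1 := by
      have : |s - σ| < 1 := by simpa [Real.dist_eq] using hs
      have := abs_sub_abs_le_abs_sub s σ
      linarith
    have h2 : ‖((2 * s, η) : Pt d)‖ ≤ 2 * (|σ| + 1) + ‖η‖ := by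
      rw [Prod.norm_def]
      refine max_le ?_ ?_
      · simp only [norm_mul, Real.norm_eq_abs, abs_two]
        linarith [norm_nonneg η]
      · simp only
        linarith [abs_nonneg σ]
    have h3 := (fderiv ℝ w (t + s ^ 2, x + s • η)).le_opNorm (2 * s, η)
    have h4 : ‖fderiv ℝ w (t + s ^ 2, x + s • η) (2 * s, η)‖ ≤ B * (2 * (|σ| + 1) + ‖η‖) :=
      h3.trans (mul_le_mul (hB _) h2 (norm_nonneg _) hB0)
    nlinarith [mul_le_mul_of_nonneg_left h4 (gaG_nonneg d η)]
  · refine Eventually.of_forall fun η s _ => ?_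
    refine HasDerivAt.const_mul _ ?_
    have h1 : HasDerivAt (fun s : ℝ => ((t + s ^ 2, x + s • η) : Pt d)) (2 * s, η) s := by
      refine HasDerivAt.prodMk ?_ ?_
      · simpa using ((hasDerivAt_id s).pow 2).const_add t
      · simpa using ((hasDerivAt_id s).smul_const η).const_add x
    exact ((h.1.differentiable (by simp) _).hasFDerivAt).comp_hasDerivAt s h1

lemma rep {d : ℕ} {u : Pt d → ℝ} (h : Ccs d u) (i : Fin d) (z : Pt d) :
    ∃ M : ℝ, 0 < M ∧ (∫ η, gaG d η) * spDeriv d i u z =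
      - ∫ σ in (0 : ℝ)..M, ∫ η, (η i * gaG d η) *
        (timeDeriv d u (z.1 + σ ^ 2, z.2 + σ • η) + lap d u (z.1 + σ ^ 2, z.2 + σ • η)) := by
  obtain ⟨t, x⟩ := z
  have hw := h.sp i
  obtain ⟨R, hR⟩ := hw.2.isCompact.isBounded.subset_closedBall (0 : Pt d)
  set M := |R| + |t| + 1 with hM
  have hMp : 0 < M := by positivity
  have hf : Ccs d (fun z => timeDeriv d u z + lap d u z) := h.tm.add h.lap
  refine ⟨M, hMp, ?_⟩
  have hder : ∀ σ : ℝ, HasDerivAt (fun σ => ∫ η, gaG d η * spDeriv d i u (t + σ ^ 2, x + σ • η))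
      (∫ η, (η i * gaG d η) *
        (timeDeriv d u (t + σ ^ 2, x + σ • η) + lap d u (t + σ ^ 2, x + σ • η))) σ := by
    intro σ
    have := H_deriv hw t x σ
    simp only [← h.sp_comm i] at this
    rwa [← slice_ibp hf] at this
  have hcont : Continuous fun σ : ℝ => ∫ η, (η i * gaG d η) *
        (timeDeriv d u (t + σ ^ 2, x + σ • η) + lap d u (t + σ ^ 2, x + σ • η)) := by
    obtain ⟨B, hB⟩ := hf.bdd
    have hfc := hf.1.continuous
    have hc := gaG_cont d
    have hm : ∀ σ : ℝ, Continuous fun η : Ed d => (timeDeriv d u (t + σ ^ 2, x + σ • η)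
        + lap d u (t + σ ^ 2, x + σ • η)) := fun σ =>
      hfc.comp (g := fun z => timeDeriv d u z + lap d u z)
        (f := fun η : Ed d => (t + σ ^ 2, x + σ • η)) (by fun_prop)
    have hm' : ∀ η : Ed d, Continuous fun σ : ℝ => (timeDeriv d u (t + σ ^ 2, x + σ • η)
        + lap d u (t + σ ^ 2, x + σ • η)) := fun η =>
      hfc.comp (g := fun z => timeDeriv d u z + lap d u z)
        (f := fun σ : ℝ => (t + σ ^ 2, x + σ • η)) (by fun_prop)
    refine continuous_of_dominated (bound := fun η => (‖η‖ * gaG d η) * B) ?_ ?_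
      ((gaG_norm_int d).mul_const B) ?_
    · intro σ
      have := hm σ
      exact Continuous.aestronglyMeasurable (by fun_prop)
    · intro σ
      refine Eventually.of_forall fun η => ?_
      rw [norm_mul, norm_mul, Real.norm_of_nonneg (gaG_nonneg d η)]
      exact mul_le_mul (mul_le_mul_of_nonneg_right (coord_le d η i) (gaG_nonneg d η)) (hB _)
        (norm_nonneg _) (mul_nonneg (norm_nonneg _) (gaG_nonneg d η))
    · exact Eventually.of_forall fun η => continuous_const.mul (hm' η)
  have ftc := intervalIntegral.integral_eq_sub_of_hasDerivAt (a := 0) (b := M)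
    (fun σ _ => hder σ) (hcont.intervalIntegrable _ _)
  simp only at ftc ⊢
  rw [ftc]
  have h0 : ∀ η : Ed d, spDeriv d i u (t + M ^ 2, x + M • η) = 0 := by
    intro η
    by_contra hne
    have h1 : (t + M ^ 2, x + M • η) ∈ tsupport (spDeriv d i u) := subset_tsupport _ hne
    have h2 := hR h1
    rw [mem_closedBall_zero_iff, Prod.norm_def] at h2
    have h3 : |t + M ^ 2| ≤ R := (le_max_left _ _).trans h2
    have h4 := le_abs_self (t + M ^ 2)
    nlinarith [neg_abs_le t, le_abs_self R, abs_nonneg R, abs_nonneg t]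
  simp [h0, integral_mul_const]

/-! ### the potential operator -/

/-- the Gaussian kernel in self-similar variables -/
def gk (d : ℕ) (η : Ed d) : ℝ≥0∞ := ENNReal.ofReal (Real.exp (-(1 / 8) * ‖η‖ ^ 2))

/-- parameter measure -/
def nuS (d : ℕ) (S : Set ℝ) : Measure (Pt d) :=
  ((volume : Measure ℝ).restrict S).prod (volume : Measure (Ed d))

/-- parabolic shift -/
def psh (d : ℕ) (p : Pt d) : Pt d := (p.1 ^ 2, p.1 • p.2)

/-- the potential -/
def TS (d : ℕ) (S : Set ℝ) (f : Pt d → ℝ≥0∞) (z : Pt d) : ℝ≥0∞ :=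
  ∫⁻ p, gk d p.2 * f (z + psh d p) ∂(nuS d S)

instance (d : ℕ) (S : Set ℝ) : SFinite (nuS d S) := by unfold nuS; infer_instance

lemma gk_meas (d : ℕ) : Measurable (gk d) := by unfold gk; fun_prop

lemma gk_meas2 (d : ℕ) : Measurable (fun p : Pt d => gk d p.2) :=
  (gk_meas d).comp measurable_snd

lemma psh_meas (d : ℕ) : Measurable (psh d) := by unfold psh; fun_prop

/-- total mass of the kernel -/
def gA (d : ℕ) : ℝ := ∫ η : Ed d, Real.exp (-(1 / 8) * ‖η‖ ^ 2)

lemma gA_pos (d : ℕ) : 0 < gA d := by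
  unfold gA
  rw [GaussianFourier.integral_rexp_neg_mul_sq_norm (by norm_num)]
  positivity

lemma gk_lint (d : ℕ) : ∫⁻ η, gk d η = ENNReal.ofReal (gA d) := by
  unfold gA gk
  rw [ofReal_integral_eq_lintegral_ofReal (ga_integrable d (by norm_num))
    (Eventually.of_forall fun _ => (Real.exp_pos _).le)]

lemma gk_nu (d : ℕ) (h : ℝ) :
    ∫⁻ p, gk d p.2 ∂(nuS d (Ioc 0 h)) = ENNReal.ofReal (h * gA d) := by
  unfold nuS
  rw [lintegral_prod _ (gk_meas2 d).aemeasurable]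
  simp only [gk_lint, lintegral_const, Measure.restrict_apply MeasurableSet.univ, univ_inter,
    Real.volume_Ioc, sub_zero]
  rw [← ENNReal.ofReal_mul (gA_pos d).le, mul_comm]

lemma TS_meas (d : ℕ) (S : Set ℝ) {f : Pt d → ℝ≥0∞} (hf : Measurable f) :
    Measurable (TS d S f) := by
  unfold TS
  have : Measurable (fun q : Pt d × Pt d => gk d q.2.2 * f (q.1 + psh d q.2)) := by
    refine ((gk_meas d).comp (by fun_prop)).mul (hf.comp ?_)
    exact measurable_fst.add ((psh_meas d).comp measurable_snd)
  exact this.lintegral_prod_right'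

instance (d : ℕ) : (volume : Measure (Pt d)).IsAddHaarMeasure := by
  rw [Measure.volume_eq_prod]; infer_instance

lemma TS_L1 (d : ℕ) (h : ℝ) {f : Pt d → ℝ≥0∞} (hf : Measurable f) :
    ∫⁻ z, TS d (Ioc 0 h) f z = ENNReal.ofReal (h * gA d) * ∫⁻ z, f z := by
  have hm : Measurable (fun q : Pt d × Pt d => gk d q.2.2 * f (q.1 + psh d q.2)) := by
    refine ((gk_meas d).comp (by fun_prop)).mul (hf.comp ?_)
    exact measurable_fst.add ((psh_meas d).comp measurable_snd)
  unfold TS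
  rw [lintegral_lintegral_swap hm.aemeasurable]
  have : ∀ p : Pt d, ∫⁻ z, gk d p.2 * f (z + psh d p) = gk d p.2 * ∫⁻ z, f z := by
    intro p
    have hm' : Measurable fun z => f (z + psh d p) := hf.comp (measurable_id.add_const _)
    rw [lintegral_const_mul _ hm',
      lintegral_add_right_eq_self f (psh d p)]
  simp only [this]
  rw [lintegral_mul_const _ (gk_meas2 d), gk_nu d h]

lemma TS_sup (d : ℕ) (h : ℝ) {f : Pt d → ℝ≥0∞} {a : ℝ≥0∞} (ha : ∀ z, f z ≤ a)
    (z : Pt d) : TS d (Ioc 0 h) f z ≤ ENNReal.ofReal (h * gA d) * a := by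
  unfold TS
  rw [← gk_nu d h, ← lintegral_mul_const _ (gk_meas2 d)]
  exact lintegral_mono fun p => mul_le_mul_right (ha _) _

lemma scale_lint (d : ℕ) {F : Ed d → ℝ≥0∞} (hF : Measurable F) (x : Ed d) {σ : ℝ} (hσ : 0 < σ) :
    ENNReal.ofReal (σ ^ d) * ∫⁻ η, F (x + σ • η) = ∫⁻ y, F y := by
  have h1 : ∫⁻ η, F (x + σ • η) = ∫⁻ y, F (x + y) ∂(Measure.map (fun η : Ed d => σ • η) volume) := by
    have hm' : Measurable fun y => F (x + y) := hF.comp (measurable_const_add x)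
    rw [lintegral_map hm' (measurable_const_smul σ)]
  rw [h1, Measure.map_addHaar_smul _ hσ.ne', lintegral_smul_measure, lintegral_add_left_eq_self F x]
  simp only [finrank_euclideanSpace, Fintype.card_fin, smul_eq_mul]
  rw [← mul_assoc, ← ENNReal.ofReal_mul (by positivity), abs_of_pos (by positivity),
    mul_inv_cancel₀ (by positivity)]
  simp

lemma sq_lint {F : ℝ → ℝ≥0∞} :
    ∫⁻ σ in Ioi (0 : ℝ), ENNReal.ofReal σ * F (σ ^ 2) ≤ ∫⁻ s, F s := by
  have h := lintegral_image_eq_lintegral_abs_deriv_mul (s := Ioi (0 : ℝ)) (f := fun σ => σ ^ 2)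
    (f' := fun σ => 2 * σ) measurableSet_Ioi
    (fun x _ => by simpa using (hasDerivAt_pow 2 x).hasDerivWithinAt)
    (fun a ha b hb hab => by
      have := (sq_eq_sq₀ (le_of_lt ha) (le_of_lt hb)).1 hab
      exact this) F
  calc ∫⁻ σ in Ioi (0 : ℝ), ENNReal.ofReal σ * F (σ ^ 2)
      ≤ ∫⁻ σ in Ioi (0 : ℝ), ENNReal.ofReal |2 * σ| * F (σ ^ 2) := by
        refine setLIntegral_mono' measurableSet_Ioi fun σ hσ => ?_
        refine mul_le_mul_left (ENNReal.ofReal_le_ofReal ?_) _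
        have : (0 : ℝ) < σ := hσ
        rw [abs_of_pos (by positivity)]; linarith
    _ = ∫⁻ s in Set.image (fun σ : ℝ => σ ^ 2) (Ioi 0), F s := h.symm
    _ ≤ ∫⁻ s, F s := setLIntegral_le_lintegral _ _

lemma cov_le (d : ℕ) {F : Pt d → ℝ≥0∞} (hF : Measurable F) (z : Pt d) {h : ℝ} (hh : 0 < h) :
    ∫⁻ p, ENNReal.ofReal (p.1 ^ (d + 1)) * F (z + psh d p) ∂(nuS d (Ioi h)) ≤ ∫⁻ w, F w := by
  have hm : Measurable fun p : Pt d => ENNReal.ofReal (p.1 ^ (d + 1)) * F (z + psh d p) :=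
    (by fun_prop : Measurable fun p : Pt d => ENNReal.ofReal (p.1 ^ (d + 1))).mul
      (hF.comp ((psh_meas d).const_add z))
  unfold nuS
  rw [lintegral_prod _ hm.aemeasurable]
  have e : ∀ σ ∈ Ioi (0 : ℝ), ∫⁻ η, ENNReal.ofReal (σ ^ (d + 1)) * F (z + psh d (σ, η))
      = ENNReal.ofReal σ * ∫⁻ y, F (z.1 + σ ^ 2, y) := by
    intro σ hσ
    have hσ : 0 < σ := hσ
    have hm' : Measurable fun η => F (z + psh d (σ, η)) :=
      hF.comp (((psh_meas d).comp measurable_prodMk_left).const_add z)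
    have hm2 : Measurable fun y => F (z.1 + σ ^ 2, y) := hF.comp measurable_prodMk_left
    rw [lintegral_const_mul _ hm',
      ← scale_lint d hm2 z.2 hσ, ← mul_assoc,
      ← ENNReal.ofReal_mul hσ.le, pow_succ, mul_comm σ]
    rfl
  calc ∫⁻ σ in Ioi h, ∫⁻ η, ENNReal.ofReal (σ ^ (d + 1)) * F (z + psh d (σ, η))
      ≤ ∫⁻ σ in Ioi 0, ∫⁻ η, ENNReal.ofReal (σ ^ (d + 1)) * F (z + psh d (σ, η)) :=
        lintegral_mono_set (Ioi_subset_Ioi hh.le)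
    _ = ∫⁻ σ in Ioi 0, ENNReal.ofReal σ * ∫⁻ y, F (z.1 + σ ^ 2, y) :=
        setLIntegral_congr_fun measurableSet_Ioi e
    _ ≤ ∫⁻ s, ∫⁻ y, F (z.1 + s, y) := sq_lint (F := fun s => ∫⁻ y, F (z.1 + s, y))
    _ = ∫⁻ s, ∫⁻ y, F (s, y) := lintegral_add_left_eq_self (fun s => ∫⁻ y, F (s, y)) z.1
    _ = ∫⁻ w, F w := by
        rw [Measure.volume_eq_prod, lintegral_prod _ hF.aemeasurable]

lemma rpow_lint {e h : ℝ} (he : 1 < e) (hh : 0 < h) :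
    ∫⁻ σ in Ioi h, ENNReal.ofReal (σ ^ (-e)) = ENNReal.ofReal (h ^ (1 - e) / (e - 1)) := by
  rw [← ofReal_integral_eq_lintegral_ofReal (integrableOn_Ioi_rpow_of_lt (by linarith) hh),
    integral_Ioi_rpow_of_lt (by linarith) hh]
  · congr 1
    rw [show -e + 1 = 1 - e by ring, show e - 1 = -(1 - e) by ring, div_neg, neg_div]
  · refine (ae_restrict_iff' measurableSet_Ioi).2 (Eventually.of_forall fun σ hσ => ?_)
    exact Real.rpow_nonneg (hh.trans hσ).le _

lemma TS_tail (d : ℕ) {q : ℝ} (hq : 1 < q) (hq' : q < (d : ℝ) + 2) :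
    ∃ C : ℝ, 0 < C ∧ ∀ f : Pt d → ℝ≥0∞, Measurable f → ∫⁻ z, f z ^ q ≤ 1 → ∀ h : ℝ, 0 < h →
      ∀ z, TS d (Ioi h) f z ≤ ENNReal.ofReal (C * h ^ (-(((d : ℝ) + 2) / q - 1))) := by
  set p := q / (q - 1) with hp
  have hq1 : 0 < q - 1 := by linarith
  have hq0 : 0 < q := by linarith
  have hpq : p.HolderConjugate q := (Real.HolderConjugate.conjExponent hq).symm
  have hp0 : 0 < p := by positivity
  set e := ((d : ℝ) + 1) * p / q with he
  have he' : e = ((d : ℝ) + 1) / (q - 1) := by rw [he, hp]; field_simp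
  have he1 : 1 < e := by rw [he', lt_div_iff₀ hq1]; linarith
  have he10 : 0 < e - 1 := by linarith
  set A' : ℝ := ∫ η : Ed d, Real.exp (-(p / 8) * ‖η‖ ^ 2) with hA'
  have hA'pos : 0 < A' := by
    rw [hA', GaussianFourier.integral_rexp_neg_mul_sq_norm (by positivity)]
    positivity
  have hA'l : ∫⁻ η : Ed d, gk d η ^ p = ENNReal.ofReal A' := by
    rw [hA', ofReal_integral_eq_lintegral_ofReal (ga_integrable d (by positivity))
      (Eventually.of_forall fun _ => (Real.exp_pos _).le)]
    refine lintegral_congr fun η => ?_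
    unfold gk
    rw [ENNReal.ofReal_rpow_of_pos (Real.exp_pos _), ← Real.exp_mul]
    congr 2; ring
  refine ⟨(A' / (e - 1)) ^ (1 / p), by positivity, fun f hf hfq h hh z => ?_⟩
  have hae : ∀ᵐ x ∂(nuS d (Ioi h)), 0 < x.1 := by
    have h0 : ∀ᵐ σ ∂((volume : Measure ℝ).restrict (Ioi h)), 0 < σ :=
      (ae_restrict_iff' measurableSet_Ioi).2 (Eventually.of_forall fun σ hσ => hh.trans hσ)
    exact Measure.quasiMeasurePreserving_fst.ae h0
  set k : ℝ := ((d : ℝ) + 1) / q with hk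
  have hm1 : Measurable fun x : Pt d => ENNReal.ofReal (x.1 ^ (-k)) * gk d x.2 :=
    (by fun_prop : Measurable fun x : Pt d => ENNReal.ofReal (x.1 ^ (-k))).mul
      ((gk_meas d).comp measurable_snd)
  have hm2 : Measurable fun x : Pt d => ENNReal.ofReal (x.1 ^ k) * f (z + psh d x) :=
    (by fun_prop : Measurable fun x : Pt d => ENNReal.ofReal (x.1 ^ k)).mul
      (hf.comp ((psh_meas d).const_add z))
  have hol := ENNReal.lintegral_mul_le_Lp_mul_Lq (nuS d (Ioi h)) hpq hm1.aemeasurable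
    hm2.aemeasurable
  have s1 : TS d (Ioi h) f z = ∫⁻ x, ((fun x : Pt d => ENNReal.ofReal (x.1 ^ (-k)) * gk d x.2) *
      (fun x : Pt d => ENNReal.ofReal (x.1 ^ k) * f (z + psh d x))) x ∂(nuS d (Ioi h)) := by
    unfold TS
    refine lintegral_congr_ae (hae.mono fun x hx => ?_)
    have : ENNReal.ofReal (x.1 ^ (-k)) * ENNReal.ofReal (x.1 ^ k) = 1 := by
      rw [← ENNReal.ofReal_mul (by positivity), ← Real.rpow_add hx]; simp
    simp only [Pi.mul_apply]
    calc gk d x.2 * f (z + psh d x) = 1 * (gk d x.2 * f (z + psh d x)) := (one_mul _).symm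
      _ = _ := by rw [← this]; ring
  have s2 : ∫⁻ x, (ENNReal.ofReal (x.1 ^ (-k)) * gk d x.2) ^ p ∂(nuS d (Ioi h))
      = ENNReal.ofReal (h ^ (1 - e) / (e - 1) * A') := by
    have : ∫⁻ x, (ENNReal.ofReal (x.1 ^ (-k)) * gk d x.2) ^ p ∂(nuS d (Ioi h))
        = ∫⁻ x : Pt d, ENNReal.ofReal (x.1 ^ (-e)) * gk d x.2 ^ p ∂(nuS d (Ioi h)) := by
      refine lintegral_congr_ae (hae.mono fun x hx => ?_)
      simp only
      rw [ENNReal.mul_rpow_of_nonneg _ _ hp0.le, ENNReal.ofReal_rpow_of_pos (by positivity),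
        ← Real.rpow_mul hx.le]
      congr 4
      rw [hk, he]; ring
    rw [this]
    unfold nuS
    rw [lintegral_prod_mul (f := fun σ : ℝ => ENNReal.ofReal (σ ^ (-e)))
      (g := fun η => gk d η ^ p) (by fun_prop) ((gk_meas d).pow_const p).aemeasurable,
      rpow_lint he1 hh, hA'l, ← ENNReal.ofReal_mul (by positivity)]
  have s3 : ∫⁻ x, (ENNReal.ofReal (x.1 ^ k) * f (z + psh d x)) ^ q ∂(nuS d (Ioi h)) ≤ 1 := by
    refine le_trans (le_of_eq ?_) ((cov_le d (hf.pow_const q) z hh).trans hfq)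
    refine lintegral_congr_ae (hae.mono fun x hx => ?_)
    simp only
    rw [ENNReal.mul_rpow_of_nonneg _ _ hq0.le, ENNReal.ofReal_rpow_of_pos (by positivity),
        ← Real.rpow_mul hx.le, hk, div_mul_cancel₀ _ hq0.ne']
    congr 2
    exact_mod_cast Real.rpow_natCast x.1 (d + 1)
  rw [s1]
  refine hol.trans ?_
  simp only [s2]
  calc _ ≤ ENNReal.ofReal (h ^ (1 - e) / (e - 1) * A') ^ (1 / p) * 1 ^ (1 / q) := by
        gcongr
    _ = ENNReal.ofReal ((A' / (e - 1)) ^ (1 / p) * h ^ (-(((d : ℝ) + 2) / q - 1))) := by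
        rw [ENNReal.one_rpow, mul_one, ENNReal.ofReal_rpow_of_pos (by positivity)]
        congr 1
        rw [show h ^ (1 - e) / (e - 1) * A' = (A' / (e - 1)) * h ^ (1 - e) by ring,
          Real.mul_rpow (by positivity) (by positivity), ← Real.rpow_mul hh.le]
        congr 2
        rw [he', hp]
        field_simp
        ring

/-! ### gradient bound -/

lemma grad_le (d : ℕ) : ∃ C : ℝ, 0 < C ∧ ∀ u : Pt d → ℝ, Ccs d u → ∀ z,
    ENNReal.ofReal (gradNorm d u z) ≤ ENNReal.ofReal C *
      TS d (Ioi 0) (fun z => ENNReal.ofReal |timeDeriv d u z + lap d u z|) z := by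
  set Z := ∫ η, gaG d η with hZdef
  have hZ : 0 < Z := gaG_Z_pos d
  refine ⟨((d : ℝ) + 1) * (2 / Z), by positivity, fun u h z => ?_⟩
  set T := TS d (Ioi 0) (fun z => ENNReal.ofReal |timeDeriv d u z + lap d u z|) z with hT
  have hf : Ccs d (fun z => timeDeriv d u z + lap d u z) := h.tm.add h.lap
  have hfm : Measurable fun z => ENNReal.ofReal |timeDeriv d u z + lap d u z| := by
    have := hf.1.continuous.measurable
    exact (this.abs).ennreal_ofReal
  have h1 : ∀ i, ENNReal.ofReal |spDeriv d i u z| ≤ ENNReal.ofReal (2 / Z) * T := by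
    intro i
    obtain ⟨M, hM, hrep⟩ := rep h i z
    have h2 : ENNReal.ofReal (Z * |spDeriv d i u z|) ≤ ENNReal.ofReal 2 * T := by
      rw [← abs_of_pos hZ, ← abs_mul, hrep, abs_neg, ← Real.norm_eq_abs, ofReal_norm,
        intervalIntegral.integral_of_le hM.le]
      refine (enorm_integral_le_lintegral_enorm _).trans ?_
      have hm : Measurable fun p : Pt d =>
          gk d p.2 * ENNReal.ofReal |timeDeriv d u (z + psh d p) + lap d u (z + psh d p)| :=
        (gk_meas2 d).mul (hfm.comp ((psh_meas d).const_add z))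
      have hT' : ENNReal.ofReal 2 * T = ∫⁻ σ in Ioi (0 : ℝ), ∫⁻ η, ENNReal.ofReal 2 *
          (gk d η * ENNReal.ofReal |timeDeriv d u (z.1 + σ ^ 2, z.2 + σ • η)
            + lap d u (z.1 + σ ^ 2, z.2 + σ • η)|) := by
        rw [hT]
        unfold TS nuS
        rw [← lintegral_const_mul _ hm, lintegral_prod _ (hm.const_mul _).aemeasurable]
        rfl
      rw [hT']
      refine (lintegral_mono_set Ioc_subset_Ioi_self).trans (lintegral_mono fun σ => ?_)
      refine (enorm_integral_le_lintegral_enorm _).trans (lintegral_mono fun η => ?_)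
      simp only
      rw [gk, ← ENNReal.ofReal_mul (Real.exp_pos _).le, ← ENNReal.ofReal_mul (by norm_num),
        ← ofReal_norm]
      refine ENNReal.ofReal_le_ofReal ?_
      rw [norm_mul, norm_mul, Real.norm_of_nonneg (gaG_nonneg d η), ← mul_assoc]
      refine mul_le_mul_of_nonneg_right ?_ (abs_nonneg _)
      exact (mul_le_mul_of_nonneg_right (coord_le d η i) (gaG_nonneg d η)).trans (gaG_norm_le d η)
    calc ENNReal.ofReal |spDeriv d i u z|
        = ENNReal.ofReal Z⁻¹ * ENNReal.ofReal (Z * |spDeriv d i u z|) := by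
          rw [← ENNReal.ofReal_mul (by positivity)]
          congr 1; field_simp
      _ ≤ ENNReal.ofReal Z⁻¹ * (ENNReal.ofReal 2 * T) := by gcongr
      _ = ENNReal.ofReal (2 / Z) * T := by
          rw [← mul_assoc, ← ENNReal.ofReal_mul (by positivity)]
          congr 2; ring
  have h3 : gradNorm d u z ≤ ∑ i, |spDeriv d i u z| := by
    unfold gradNorm
    rw [Real.sqrt_le_left (Finset.sum_nonneg fun i _ => abs_nonneg _)]
    simp only [← sq_abs (spDeriv d _ u z)]
    exact Finset.sum_sq_le_sq_sum_of_nonneg fun i _ => abs_nonneg _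
  calc ENNReal.ofReal (gradNorm d u z) ≤ ENNReal.ofReal (∑ i, |spDeriv d i u z|) :=
        ENNReal.ofReal_le_ofReal h3
    _ = ∑ i, ENNReal.ofReal |spDeriv d i u z| :=
        ENNReal.ofReal_sum_of_nonneg fun i _ => abs_nonneg _
    _ ≤ ∑ i : Fin d, ENNReal.ofReal (2 / Z) * T := Finset.sum_le_sum fun i _ => h1 i
    _ = ENNReal.ofReal d * (ENNReal.ofReal (2 / Z) * T) := by simp
    _ ≤ ENNReal.ofReal ((d : ℝ) + 1) * (ENNReal.ofReal (2 / Z) * T) := by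
        gcongr; linarith
    _ = ENNReal.ofReal (((d : ℝ) + 1) * (2 / Z)) * T := by
        rw [← mul_assoc, ← ENNReal.ofReal_mul (by positivity)]

/-! ### Hardy-Littlewood-Sobolev type bound -/

lemma TS_weak (d : ℕ) {q r : ℝ} (hq : 1 < q) (hq' : q < (d : ℝ) + 2) (hr0 : 0 < r)
    (hr : ((d : ℝ) + 2) / q - 1 = ((d : ℝ) + 2) / r) :
    ∃ c : ℝ, 0 < c ∧ ∀ f : Pt d → ℝ≥0∞, Measurable f → ∫⁻ z, f z ^ q ≤ 1 → ∀ μ : ℝ, 0 < μ →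
      volume {z | ENNReal.ofReal μ < TS d (Ioi 0) f z} ≤ ENNReal.ofReal ((c * μ ^ (r / q))⁻¹) *
        ∫⁻ z, {z | ENNReal.ofReal (c * μ ^ (r / q)) < f z}.indicator f z := by
  obtain ⟨C, hC, htail⟩ := TS_tail d hq hq'
  have hA := gA_pos d
  have hq0 : 0 < q := by linarith
  set β := ((d : ℝ) + 2) / r with hβ
  have hβ0 : 0 < β := by positivity
  have hexp : r / q = 1 + 1 / β := by
    have hr2 := hr
    rw [hβ] at hr2 ⊢
    field_simp at hr2 ⊢
    linarith
  set c : ℝ := (1 / 3) ^ (r / q) * (C ^ (1 / β))⁻¹ * (gA d)⁻¹ with hc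
  refine ⟨c, by positivity, fun f hf hfq μ hμ => ?_⟩
  set l := μ / 3 with hl
  have hl0 : 0 < l := by positivity
  set h := (C / l) ^ (1 / β) with hh
  have hh0 : 0 < h := by positivity
  set a := c * μ ^ (r / q) with ha
  have ha0 : 0 < a := by positivity
  have hha : h * gA d = l / a := by
    rw [eq_div_iff ha0.ne', ha, hc, hh, Real.div_rpow hC.le hl0.le]
    have : (1 / 3 : ℝ) ^ (r / q) * μ ^ (r / q) = l * l ^ (1 / β) := by
      rw [← Real.mul_rpow (by norm_num) hμ.le, hexp, Real.rpow_add (by positivity), Real.rpow_one]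
      rw [show 1 / 3 * μ = l by rw [hl]; ring]
    have h1 : 0 < C ^ (1 / β) := by positivity
    have h2 : 0 < l ^ (1 / β) := by positivity
    calc _ = ((1 / 3 : ℝ) ^ (r / q) * μ ^ (r / q)) / l ^ (1 / β)
          * (C ^ (1 / β) * (C ^ (1 / β))⁻¹) * (gA d * (gA d)⁻¹) := by ring
      _ = l := by
        rw [this, mul_inv_cancel₀ h1.ne', mul_inv_cancel₀ hA.ne']
        field_simp
  have htl : ∀ z, TS d (Ioi h) f z ≤ ENNReal.ofReal l := by
    intro z
    refine (htail f hf hfq h hh0 z).trans (le_of_eq ?_)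
    congr 1
    rw [hr, hh, ← Real.rpow_mul (by positivity), show 1 / β * -β = -1 by field_simp,
      Real.rpow_neg_one]
    field_simp
  set E : Set (Pt d) := {z | ENNReal.ofReal a < f z} with hE
  have hEm : MeasurableSet E := measurableSet_lt measurable_const hf
  have hlow : ∀ z, TS d (Ioc 0 h) (Eᶜ.indicator f) z ≤ ENNReal.ofReal l := by
    intro z
    refine (TS_sup d h (a := ENNReal.ofReal a) (fun z => ?_) z).trans (le_of_eq ?_)
    · by_cases hz : z ∈ E
      · simp [hz]
      · simpa [hz] using not_lt.1 hz
    · rw [hha, ← ENNReal.ofReal_mul (by positivity)]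
      congr 1; field_simp
  have hsplit : ∀ z, TS d (Ioi 0) f z ≤ TS d (Ioc 0 h) (Eᶜ.indicator f) z
      + TS d (Ioc 0 h) (E.indicator f) z + TS d (Ioi h) f z := by
    intro z
    have e1 : nuS d (Ioi 0) = nuS d (Ioc 0 h) + nuS d (Ioi h) := by
      unfold nuS
      rw [← Measure.add_prod, ← Measure.restrict_union _ measurableSet_Ioi,
        Ioc_union_Ioi_eq_Ioi hh0.le]
      exact disjoint_left.2 fun x hx hx' => not_lt.2 hx.2 hx'
    have e2 : TS d (Ioi 0) f z = TS d (Ioc 0 h) f z + TS d (Ioi h) f z := by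
      unfold TS
      rw [e1, lintegral_add_measure]
    have hm : Measurable fun p : Pt d => gk d p.2 * Eᶜ.indicator f (z + psh d p) :=
      (gk_meas2 d).mul ((hf.indicator hEm.compl).comp ((psh_meas d).const_add z))
    have e3 : TS d (Ioc 0 h) f z = TS d (Ioc 0 h) (Eᶜ.indicator f) z
        + TS d (Ioc 0 h) (E.indicator f) z := by
      unfold TS
      rw [← lintegral_add_left hm]
      refine lintegral_congr fun p => ?_
      rw [← mul_add]
      congr 1
      exact (congrFun (indicator_compl_add_self E f) _).symm
    rw [e2, e3]
  have hsub : {z | ENNReal.ofReal μ < TS d (Ioi 0) f z}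
      ⊆ {z | ENNReal.ofReal l ≤ TS d (Ioc 0 h) (E.indicator f) z} := by
    intro z hz
    by_contra hn
    have hn : TS d (Ioc 0 h) (E.indicator f) z < ENNReal.ofReal l := not_le.1 hn
    have h1 : TS d (Ioi 0) f z ≤ ENNReal.ofReal l + ENNReal.ofReal l + ENNReal.ofReal l :=
      (hsplit z).trans (add_le_add (add_le_add (hlow z) hn.le) (htl z))
    rw [← ENNReal.ofReal_add hl0.le hl0.le, ← ENNReal.ofReal_add (by positivity) hl0.le,
      show l + l + l = μ by rw [hl]; ring] at h1
    exact absurd hz (not_lt.2 h1)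
  have hind : Measurable (E.indicator f) := hf.indicator hEm
  have mk := mul_meas_ge_le_lintegral (μ := volume) (TS_meas d (Ioc 0 h) hind) (ENNReal.ofReal l)
  rw [TS_L1 d h hind, hha] at mk
  calc volume {z | ENNReal.ofReal μ < TS d (Ioi 0) f z}
      ≤ volume {z | ENNReal.ofReal l ≤ TS d (Ioc 0 h) (E.indicator f) z} := measure_mono hsub
    _ = ENNReal.ofReal l⁻¹ * (ENNReal.ofReal l *
          volume {z | ENNReal.ofReal l ≤ TS d (Ioc 0 h) (E.indicator f) z}) := by
        rw [← mul_assoc, ← ENNReal.ofReal_mul (by positivity), inv_mul_cancel₀ hl0.ne']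
        simp
    _ ≤ ENNReal.ofReal l⁻¹ * (ENNReal.ofReal (l / a) * ∫⁻ z, E.indicator f z) := by gcongr
    _ = ENNReal.ofReal a⁻¹ * ∫⁻ z, E.indicator f z := by
        rw [← mul_assoc, ← ENNReal.ofReal_mul (by positivity)]
        congr 2; field_simp

lemma TS_strong (d : ℕ) {q r : ℝ} (hq : 1 < q) (hq' : q < (d : ℝ) + 2) (hr0 : 0 < r)
    (hr : ((d : ℝ) + 2) / q - 1 = ((d : ℝ) + 2) / r) :
    ∃ C : ℝ, 0 < C ∧ ∀ f g : Pt d → ℝ, Measurable f → Measurable g → (∀ z, 0 ≤ f z) →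
      (∀ z, 0 ≤ g z) → (∀ z, ENNReal.ofReal (g z) ≤ TS d (Ioi 0) (fun z => ENNReal.ofReal (f z)) z) →
      ∫⁻ z, ENNReal.ofReal (f z) ^ q ≤ 1 → ∫⁻ z, ENNReal.ofReal (g z) ^ r ≤ ENNReal.ofReal C := by
  obtain ⟨c, hc, hweak⟩ := TS_weak d hq hq' hr0 hr
  have hq0 : 0 < q := by linarith
  set k := r / q with hk
  have hk0 : 0 < k := by positivity
  set e := r - k with he
  have hee : e = k * (q - 1) := by rw [he, hk]; field_simp
  have he0 : 0 < e := by rw [hee]; exact mul_pos hk0 (by linarith)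
  refine ⟨r * (c⁻¹ * (1 / c) ^ (q - 1) / e), by positivity,
    fun f g hf hg hf0 hg0 hle hfq => ?_⟩
  have hfm : Measurable fun z => ENNReal.ofReal (f z) := hf.ennreal_ofReal
  have lc := lintegral_rpow_eq_lintegral_meas_lt_mul volume (Eventually.of_forall hg0)
    hg.aemeasurable hr0
  have lc1 : ∫⁻ z, ENNReal.ofReal (g z) ^ r = ∫⁻ z, ENNReal.ofReal (g z ^ r) :=
    lintegral_congr fun z => ENNReal.ofReal_rpow_of_nonneg (hg0 z) hr0.le
  rw [lc1, lc]
  -- the two-variable integrand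
  set Φ : ℝ → Pt d → ℝ≥0∞ := fun t z => ENNReal.ofReal (c⁻¹ * t ^ (e - 1)) *
    {p : ℝ × Pt d | c * p.1 ^ k < f p.2}.indicator (fun p => ENNReal.ofReal (f p.2)) (t, z) with hΦ
  have hΦm : Measurable (Function.uncurry Φ) := by
    refine Measurable.mul (f := fun p : ℝ × Pt d => ENNReal.ofReal (c⁻¹ * p.1 ^ (e - 1)))
      (g := {p : ℝ × Pt d | c * p.1 ^ k < f p.2}.indicator (fun p => ENNReal.ofReal (f p.2)))
      (by fun_prop) ?_
    refine Measurable.indicator (hfm.comp measurable_snd) ?_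
    exact measurableSet_lt (by fun_prop) (hf.comp measurable_snd)
  have step1 : ∫⁻ t in Ioi (0 : ℝ), volume {z | t < g z} * ENNReal.ofReal (t ^ (r - 1))
      ≤ ∫⁻ t in Ioi (0 : ℝ), ∫⁻ z, Φ t z := by
    refine setLIntegral_mono' measurableSet_Ioi fun t ht => ?_
    have ht : 0 < t := ht
    have h1 : volume {z | t < g z} ≤ _ := (measure_mono (fun z (hz : t < g z) => by
      exact ((ENNReal.ofReal_lt_ofReal_iff (ht.trans hz)).2 hz).trans_le (hle z))).trans
      (hweak _ hfm hfq t ht)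
    have h2 : ∫⁻ z, Φ t z = ENNReal.ofReal (c⁻¹ * t ^ (e - 1)) *
        ∫⁻ z, {z | ENNReal.ofReal (c * t ^ k) < ENNReal.ofReal (f z)}.indicator
          (fun z => ENNReal.ofReal (f z)) z := by
      rw [← lintegral_const_mul _ (hfm.indicator (measurableSet_lt measurable_const hfm))]
      refine lintegral_congr fun z => ?_
      rw [hΦ]
      simp only [indicator, mem_ofPred_eq]
      congr 1
      have : c * t ^ k < f z ↔ ENNReal.ofReal (c * t ^ k) < ENNReal.ofReal (f z) :=
        (ENNReal.ofReal_lt_ofReal_iff_of_nonneg (by positivity)).symm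
      simp only [this]
    rw [h2]
    refine (mul_le_mul_left h1 _).trans (le_of_eq ?_)
    rw [mul_right_comm, ← ENNReal.ofReal_mul (by positivity)]
    congr 2
    rw [mul_inv, ← Real.rpow_neg ht.le, mul_assoc, ← Real.rpow_add ht]
    congr 2
    rw [he]; ring
  have step2 : ∀ z, ∫⁻ t in Ioi (0 : ℝ), Φ t z
      ≤ ENNReal.ofReal (c⁻¹ * (1 / c) ^ (q - 1) / e) * ENNReal.ofReal (f z) ^ q := by
    intro z
    rcases (hf0 z).eq_or_lt with h0 | hpos
    · have : ∀ t, Φ t z = 0 := by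
        intro t
        simp [hΦ, indicator, ← h0]
      simp [this]
    set Mz := (f z / c) ^ (1 / k) with hMz
    have hM0 : 0 < Mz := by positivity
    have h1 : ∫⁻ t in Ioi (0 : ℝ), Φ t z ≤
        ∫⁻ t in Ioc (0 : ℝ) Mz, ENNReal.ofReal (c⁻¹ * t ^ (e - 1) * f z) := by
      rw [← lintegral_indicator measurableSet_Ioi, ← lintegral_indicator measurableSet_Ioc]
      refine lintegral_mono fun t => ?_
      by_cases ht : 0 < t
      · by_cases hlt : c * t ^ k < f z
        · have htM : t ≤ Mz := by
            have : t ^ k ≤ f z / c := by rw [le_div_iff₀ hc]; linarith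
            calc t = (t ^ k) ^ (1 / k) := by
                  rw [← Real.rpow_mul ht.le, mul_one_div_cancel hk0.ne', Real.rpow_one]
              _ ≤ _ := Real.rpow_le_rpow (by positivity) this (by positivity)
          have ht' : t ∈ Ioc 0 Mz := ⟨ht, htM⟩
          rw [indicator_of_mem (show t ∈ Ioi (0 : ℝ) from ht), indicator_of_mem ht',
            ENNReal.ofReal_mul (by positivity)]
          simp [hΦ, indicator, hlt]
        · simp [hΦ, indicator, hlt]
      · simp [indicator, ht]
    refine h1.trans (le_of_eq ?_)
    have hint : IntervalIntegrable (fun t : ℝ => t ^ (e - 1)) volume 0 Mz :=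
      intervalIntegral.intervalIntegrable_rpow' (by linarith)
    have hint2 : IntegrableOn (fun t : ℝ => c⁻¹ * t ^ (e - 1) * f z) (Ioc 0 Mz) :=
      (((intervalIntegrable_iff_integrableOn_Ioc_of_le hM0.le).1 hint).const_mul _).mul_const _
    rw [← ofReal_integral_eq_lintegral_ofReal hint2
      ((ae_restrict_iff' measurableSet_Ioc).2 (Eventually.of_forall fun t ht => by
        have : 0 < t := ht.1
        positivity)),
      ← intervalIntegral.integral_of_le hM0.le, intervalIntegral.integral_mul_const,
      intervalIntegral.integral_const_mul, integral_rpow (Or.inl (by linarith)),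
      ENNReal.ofReal_rpow_of_pos hpos, ← ENNReal.ofReal_mul (by positivity)]
    congr 1
    have h3 : Mz ^ e = f z ^ (q - 1) * (1 / c) ^ (q - 1) := by
      rw [hMz, ← Real.rpow_mul (by positivity), ← Real.mul_rpow hpos.le (by positivity), hee]
      congr 1
      · ring
      · field_simp
    have h4 : f z ^ q = f z ^ (q - 1) * f z := by
      rw [← Real.rpow_add_one hpos.ne']; congr 1; ring
    rw [show e - 1 + 1 = e by ring, Real.zero_rpow he0.ne', h3, h4]
    ring
  calc ENNReal.ofReal r * ∫⁻ t in Ioi (0 : ℝ), volume {z | t < g z} * ENNReal.ofReal (t ^ (r - 1))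
      ≤ ENNReal.ofReal r * ∫⁻ t in Ioi (0 : ℝ), ∫⁻ z, Φ t z := by gcongr
    _ = ENNReal.ofReal r * ∫⁻ z, ∫⁻ t in Ioi (0 : ℝ), Φ t z := by
        rw [lintegral_lintegral_swap hΦm.aemeasurable]
    _ ≤ ENNReal.ofReal r * ∫⁻ z, ENNReal.ofReal (c⁻¹ * (1 / c) ^ (q - 1) / e)
          * ENNReal.ofReal (f z) ^ q := by
        gcongr with z; exact step2 z
    _ = ENNReal.ofReal r * (ENNReal.ofReal (c⁻¹ * (1 / c) ^ (q - 1) / e)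
          * ∫⁻ z, ENNReal.ofReal (f z) ^ q) := by
        rw [lintegral_const_mul _ (hfm.pow_const q)]
    _ ≤ ENNReal.ofReal r * (ENNReal.ofReal (c⁻¹ * (1 / c) ^ (q - 1) / e) * 1) := by gcongr
    _ = ENNReal.ofReal (r * (c⁻¹ * (1 / c) ^ (q - 1) / e)) := by
        rw [mul_one, ← ENNReal.ofReal_mul hr0.le]

lemma TS_smul (d : ℕ) (S : Set ℝ) {f : Pt d → ℝ≥0∞} (hf : Measurable f) (a : ℝ≥0∞) (z : Pt d) :
    TS d S (fun z => a * f z) z = a * TS d S f z := by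
  have hm : Measurable fun p : Pt d => gk d p.2 * f (z + psh d p) :=
    (gk_meas2 d).mul (hf.comp ((psh_meas d).const_add z))
  unfold TS
  rw [← lintegral_const_mul _ hm]
  exact lintegral_congr fun p => by ring

lemma LpNormE_smul (d : ℕ) {p : ℝ} (hp : 0 < p) {f : Pt d → ℝ≥0∞} (hf : Measurable f) (a : ℝ≥0∞) :
    LpNormE d p (fun z => a * f z) = a * LpNormE d p f := by
  unfold LpNormE
  simp only [ENNReal.mul_rpow_of_nonneg _ _ hp.le]
  rw [lintegral_const_mul _ (hf.pow_const p), ENNReal.mul_rpow_of_nonneg _ _ (by positivity),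
    ← ENNReal.rpow_mul, mul_one_div_cancel hp.ne', ENNReal.rpow_one]

/-- Corollary 2.4, second part: if `1 < q < d+2` and
`(d+2)/q − 1 = (d+2)/r`, then `‖Du‖_{L_r} ≤ N ‖∂_t u + Δu‖_{L_q}` for `u ∈ C_0^∞`. -/
theorem stmt4 (d : ℕ) (hd : 1 ≤ d) (q r : ℝ) (hq : 1 < q) (hq' : q < (d : ℝ) + 2)
    (hr : ((d : ℝ) + 2) / q - 1 = ((d : ℝ) + 2) / r) :
    ∃ N : ℝ, 0 < N ∧ ∀ u : Pt d → ℝ, ContDiff ℝ (⊤ : ℕ∞) u → HasCompactSupport u →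
      LpNormE d r (fun z => ENNReal.ofReal (gradNorm d u z)) ≤
        ENNReal.ofReal N *
          LpNormE d q (fun z => ENNReal.ofReal |timeDeriv d u z + lap d u z|) := by
  have hq0 : 0 < q := by linarith
  have hr0 : 0 < r := by
    have h1 : 0 < ((d : ℝ) + 2) / r := by
      rw [← hr, sub_pos, lt_div_iff₀ hq0]; linarith
    exact (div_pos_iff_of_pos_left (by positivity)).1 h1
  obtain ⟨C1, hC1, hgrad⟩ := grad_le d
  obtain ⟨C2, hC2, hstr⟩ := TS_strong d hq hq' hr0 hr
  refine ⟨C1 * C2 ^ (1 / r), by positivity, fun u hu hus => ?_⟩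
  have h : Ccs d u := ⟨hu, hus⟩
  have hfc : Continuous (fun z => timeDeriv d u z + lap d u z) := (h.tm.add h.lap).1.continuous
  set f : Pt d → ℝ := fun z => |timeDeriv d u z + lap d u z| with hf
  have hfm : Measurable f := hfc.measurable.abs
  have hfm' : Measurable fun z => ENNReal.ofReal (f z) := hfm.ennreal_ofReal
  have hgm : Measurable (gradNorm d u) := by
    unfold gradNorm
    have : ∀ i, Measurable (spDeriv d i u) := fun i => (h.sp i).1.continuous.measurable
    fun_prop
  have hgm' : Measurable fun z => ENNReal.ofReal (gradNorm d u z) := hgm.ennreal_ofReal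
  have hg0 : ∀ z, 0 ≤ gradNorm d u z := fun z => Real.sqrt_nonneg _
  have main : ∀ δ : ℝ, 0 < δ → LpNormE d q (fun z => ENNReal.ofReal (f z)) ≤ ENNReal.ofReal δ →
      LpNormE d r (fun z => ENNReal.ofReal (gradNorm d u z))
        ≤ ENNReal.ofReal (C1 * C2 ^ (1 / r)) * ENNReal.ofReal δ := by
    intro δ hδ hN
    have e1 : ∀ z, ENNReal.ofReal (δ⁻¹ * f z) = ENNReal.ofReal δ⁻¹ * ENNReal.ofReal (f z) :=
      fun z => ENNReal.ofReal_mul (by positivity)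
    have e2 : ∀ z, ENNReal.ofReal ((C1 * δ)⁻¹ * gradNorm d u z)
        = ENNReal.ofReal (C1 * δ)⁻¹ * ENNReal.ofReal (gradNorm d u z) :=
      fun z => ENNReal.ofReal_mul (by positivity)
    have := hstr (fun z => δ⁻¹ * f z) (fun z => (C1 * δ)⁻¹ * gradNorm d u z)
      (hfm.const_mul _) (hgm.const_mul _) (fun z => mul_nonneg (by positivity) (abs_nonneg _))
      (fun z => mul_nonneg (by positivity) (hg0 z))
      (fun z => by
        simp only [e1, e2]
        rw [TS_smul d _ hfm']
        refine (mul_le_mul_right (hgrad u h z) _).trans (le_of_eq ?_)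
        rw [← mul_assoc, ← ENNReal.ofReal_mul (by positivity)]
        congr 2
        field_simp)
      (by
        have h1 : LpNormE d q (fun z => ENNReal.ofReal (δ⁻¹ * f z)) ≤ 1 := by
          simp only [e1]
          rw [LpNormE_smul d hq0 hfm']
          refine (mul_le_mul_right hN _).trans (le_of_eq ?_)
          rw [← ENNReal.ofReal_mul (by positivity), inv_mul_cancel₀ hδ.ne', ENNReal.ofReal_one]
        unfold LpNormE at h1
        have h2 := ENNReal.rpow_le_rpow h1 hq0.le
        rwa [← ENNReal.rpow_mul, one_div_mul_cancel hq0.ne', ENNReal.rpow_one,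
          ENNReal.one_rpow] at h2)
    have h3 : LpNormE d r (fun z => ENNReal.ofReal ((C1 * δ)⁻¹ * gradNorm d u z))
        ≤ ENNReal.ofReal (C2 ^ (1 / r)) := by
      unfold LpNormE
      rw [← ENNReal.ofReal_rpow_of_pos hC2]
      exact ENNReal.rpow_le_rpow this (by positivity)
    simp only [e2] at h3
    rw [LpNormE_smul d hr0 hgm'] at h3
    calc LpNormE d r (fun z => ENNReal.ofReal (gradNorm d u z))
        = ENNReal.ofReal (C1 * δ) * (ENNReal.ofReal (C1 * δ)⁻¹ *
            LpNormE d r (fun z => ENNReal.ofReal (gradNorm d u z))) := by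
          rw [← mul_assoc, ← ENNReal.ofReal_mul (by positivity), mul_inv_cancel₀ (by positivity),
            ENNReal.ofReal_one, one_mul]
      _ ≤ ENNReal.ofReal (C1 * δ) * ENNReal.ofReal (C2 ^ (1 / r)) := by gcongr
      _ = _ := by
          rw [← ENNReal.ofReal_mul (by positivity), ← ENNReal.ofReal_mul (by positivity)]
          congr 1; ring
  set A := LpNormE d q (fun z => ENNReal.ofReal (f z)) with hA
  set K := C1 * C2 ^ (1 / r) with hK
  have hK0 : 0 < K := by positivity
  by_cases hAtop : A = ∞
  · change _ ≤ ENNReal.ofReal K * A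
    rw [hAtop, ENNReal.mul_top (by simpa using hK0)]
    exact le_top
  change _ ≤ ENNReal.ofReal K * A
  refine ENNReal.le_of_forall_pos_le_add fun ε hε _ => ?_
  have hε' : (0 : ℝ) < ε := hε
  have hd1 : 0 < A.toReal + ε / K := by positivity
  have hAe : ENNReal.ofReal (A.toReal + ε / K) = A + ENNReal.ofReal (ε / K) := by
    rw [ENNReal.ofReal_add ENNReal.toReal_nonneg (by positivity), ENNReal.ofReal_toReal hAtop]
  refine (main _ hd1 (by rw [hAe]; exact le_self_add)).trans (le_of_eq ?_)
  rw [hAe, mul_add, ← ENNReal.ofReal_mul hK0.le, mul_div_cancel₀ _ hK0.ne',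
    ENNReal.ofReal_coe_nnreal]
end
end
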